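/- Let R be a commutative Noetherian ring, 𝔞 an ideal of R, t ≥ 0 an integer, and M an R-module such that Ext^i_R(R/𝔞, M) is a finitely generated R-module for all i ≤ t+1. Suppose the local cohomology modules H^i_𝔞(M) are FD_{<2} R-modules for all i < t. Then H^i_𝔞(M) is 𝔞-cofinite for all i < t. -/

import Mathlib

universe u

open CategoryTheory

/-- The `i`-th Ext module `Ext^i_R(N, M)`. -/
noncomputable def extModule (R : Type u) [CommRing R] (N M : Type u)
    [AddCommGroup N] [Module R N] [AddCommGroup M] [Module R M] (i : ℕ) :
    ModuleCat.{u} R :=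
  ((Ext R (ModuleCat.{u} R) i).obj (Opposite.op (ModuleCat.of R N))).obj (ModuleCat.of R M)

/-- The `i`-th local cohomology module `H^i_𝔞(M)`. -/
noncomputable def localCohomologyModule (R : Type u) [CommRing R] (𝔞 : Ideal R)
    (M : Type u) [AddCommGroup M] [Module R M] (i : ℕ) : ModuleCat.{u} R :=
  (localCohomology 𝔞 i).obj (ModuleCat.of R M)

/-- An `R`-module `M` is `𝔞`-cofinite if `Supp M ⊆ V(𝔞)` and all the modules
`Ext^i_R(R/𝔞, M)` are finitely generated. -/
def IsCofinite (R : Type u) [CommRing R] (𝔞 : Ideal R)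
    (M : Type u) [AddCommGroup M] [Module R M] : Prop :=
  Module.support R M ⊆ PrimeSpectrum.zeroLocus (𝔞 : Set R) ∧
    ∀ i : ℕ, Module.Finite R (extModule R (R ⧸ 𝔞) M i)

/-- An `R`-module `M` is `FD_{<n}` if it has a finitely generated submodule `N` such that
the (Krull) dimension of the support of `M/N` is `< n`. -/
def IsFDLT (R : Type u) [CommRing R] (n : ℕ)
    (M : Type u) [AddCommGroup M] [Module R M] : Prop :=
  ∃ N : Submodule R M, N.FG ∧
    Order.krullDim (Module.support R (M ⧸ N)) < ((n : ℕ∞) : WithBot ℕ∞)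

namespace ExtComparison

variable {R : Type u} [CommRing R]

open Limits HomologicalComplex

lemma smul_extMk {N Y : ModuleCat.{u} R} (P : ProjectiveResolution N) {n : ℕ} (r : R)
    (f : P.complex.X n ⟶ Y) (m : ℕ) (hm : n + 1 = m) (hf : P.complex.d m n ≫ f = 0) :
    P.extMk (r • f) m hm (by simp [hf]) = r • P.extMk f m hm hf := by
  have h := P.extMk_comp_mk₀ f m hm hf (r • 𝟙 Y)
  rw [Abelian.Ext.mk₀_smul, Abelian.Ext.comp_smul, Abelian.Ext.comp_mk₀_id] at h
  rw [h]
  simp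

/-- The morphism underlying a cocycle in the complex of morphisms from a projective
resolution. -/
noncomputable def cocycleHom {N : ModuleCat.{u} R} (P : ProjectiveResolution N)
    (Y : ModuleCat.{u} R) (n : ℕ) :
    (P.complex.linearYonedaObj R Y).cycles n →ₗ[R] (P.complex.X n ⟶ Y) :=
  ((P.complex.linearYonedaObj R Y).iCycles n).hom

lemma cocycleHom_injective {N : ModuleCat.{u} R} (P : ProjectiveResolution N)
    (Y : ModuleCat.{u} R) (n : ℕ) : Function.Injective (cocycleHom P Y n) :=
  (ModuleCat.mono_iff_injective ((P.complex.linearYonedaObj R Y).iCycles n)).1 inferInstance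

lemma d_comp_cocycleHom {N : ModuleCat.{u} R} (P : ProjectiveResolution N)
    (Y : ModuleCat.{u} R) (n : ℕ) (z : (P.complex.linearYonedaObj R Y).cycles n) :
    P.complex.d (n + 1) n ≫ cocycleHom P Y n z = 0 := by
  have := (P.complex.linearYonedaObj R Y).iCycles_d n (n + 1)
  exact congr($this z)

lemma cocycleHom_toCycles {N : ModuleCat.{u} R} (P : ProjectiveResolution N)
    (Y : ModuleCat.{u} R) (m n : ℕ) (g : P.complex.X m ⟶ Y) :
    cocycleHom P Y n ((P.complex.linearYonedaObj R Y).toCycles m n g) =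
      P.complex.d n m ≫ g :=
  congr($((P.complex.linearYonedaObj R Y).toCycles_i m n) g)

lemma cocycleHom_surjective {N : ModuleCat.{u} R} (P : ProjectiveResolution N)
    (Y : ModuleCat.{u} R) (n : ℕ) (f : P.complex.X n ⟶ Y)
    (hf : P.complex.d (n + 1) n ≫ f = 0) : ∃ z, cocycleHom P Y n z = f :=
  ⟨(P.complex.linearYonedaObj R Y).cyclesMk (C := ModuleCat.{u} R) f (n + 1) (by simp) hf,
    (P.complex.linearYonedaObj R Y).i_cyclesMk (C := ModuleCat.{u} R) f (n + 1) (by simp) hf⟩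

/-- The class in `Abelian.Ext` of a cocycle in the complex of morphisms from a projective
resolution. -/
noncomputable def cyclesToExt {N : ModuleCat.{u} R} (P : ProjectiveResolution N)
    (Y : ModuleCat.{u} R) (n : ℕ) :
    (P.complex.linearYonedaObj R Y).cycles n →ₗ[R] Abelian.Ext N Y n where
  toFun z := P.extMk (cocycleHom P Y n z) (n + 1) rfl (d_comp_cocycleHom P Y n z)
  map_add' a b := by
    rw [P.add_extMk]
    congr 1
    exact map_add (cocycleHom P Y n) a b
  map_smul' r a := by
    rw [RingHom.id_apply, ← smul_extMk]
    congr 1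
    exact map_smul (cocycleHom P Y n) r a

lemma cyclesToExt_surjective {N : ModuleCat.{u} R} (P : ProjectiveResolution N)
    (Y : ModuleCat.{u} R) (n : ℕ) : Function.Surjective (cyclesToExt P Y n) := by
  intro c
  obtain ⟨f, hf, rfl⟩ := P.extMk_surjective c (n + 1) rfl
  obtain ⟨z, rfl⟩ := cocycleHom_surjective P Y n f hf
  exact ⟨z, rfl⟩

lemma toCycles_comp_cyclesToExt {N : ModuleCat.{u} R} (P : ProjectiveResolution N)
    (Y : ModuleCat.{u} R) (m n : ℕ) :
    (P.complex.linearYonedaObj R Y).toCycles m n ≫ ModuleCat.ofHom (cyclesToExt P Y n) = 0 := by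
  by_cases h : m + 1 = n
  · ext g
    exact (P.extMk_eq_zero_iff (cocycleHom P Y n _) (n + 1) rfl
      (d_comp_cocycleHom P Y n _) m h).2 ⟨g, (cocycleHom_toCycles P Y m n g).symm⟩
  · ext g
    have h0 := (P.complex.linearYonedaObj R Y).toCycles_eq_zero (i := m) (j := n) (by simpa using h)
    exact (congrArg (cyclesToExt P Y n) (congr($h0 g))).trans (map_zero _)

lemma eq_zero_of_extMk_eq_zero {N Y : ModuleCat.{u} R} (P : ProjectiveResolution N)
    (f : P.complex.X 0 ⟶ Y) (hf : P.complex.d 1 0 ≫ f = 0) (h : P.extMk f 1 rfl hf = 0) :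
    f = 0 := by
  rw [← P.extEquivCohomologyClass.apply_eq_iff_eq,
    ProjectiveResolution.extEquivCohomologyClass_extMk,
    ProjectiveResolution.extEquivCohomologyClass_zero,
    CochainComplex.HomComplex.CohomologyClass.mk_eq_zero_iff] at h
  rw [CochainComplex.HomComplex.Cocycle.toSingleMk_mem_coboundaries_iff _ _ _ _ _ 1 (by simp)] at h
  obtain ⟨g, hg⟩ := h
  have hz : IsZero (P.cochainComplex.X 1) :=
    CochainComplex.isZero_of_isStrictlyLE _ 0 _ (by simp)
  rw [hz.eq_of_src g 0, comp_zero] at hg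
  rw [← cancel_epi (P.cochainComplexXIso (-(0 : ℕ)) 0 rfl).hom, comp_zero]
  exact hg.symm

lemma exists_toCycles_eq {N : ModuleCat.{u} R} (P : ProjectiveResolution N)
    (Y : ModuleCat.{u} R) (n : ℕ) (z : (P.complex.linearYonedaObj R Y).cycles n)
    (hz : cyclesToExt P Y n z = 0) : ∃ m g, (P.complex.linearYonedaObj R Y).toCycles m n g = z := by
  cases n with
  | zero =>
    refine ⟨0, 0, ?_⟩
    rw [map_zero]
    apply cocycleHom_injective
    rw [map_zero]
    symm
    have hd := d_comp_cocycleHom P Y 0 z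
    change P.extMk (cocycleHom P Y 0 z) 1 rfl hd = 0 at hz
    exact eq_zero_of_extMk_eq_zero P _ hd hz
  | succ p =>
    obtain ⟨g, hg⟩ := (P.extMk_eq_zero_iff (cocycleHom P Y (p + 1) z) (p + 1 + 1) rfl
      (d_comp_cocycleHom P Y (p + 1) z) p rfl).1 hz
    refine ⟨p, g, cocycleHom_injective P Y _ ?_⟩
    exact (cocycleHom_toCycles P Y p (p + 1) g).trans hg

/-- The map from the cohomology of the complex of morphisms from a projective resolution to
`Abelian.Ext`. -/
noncomputable def homologyToExt {N : ModuleCat.{u} R} (P : ProjectiveResolution N)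
    (Y : ModuleCat.{u} R) (n : ℕ) :
    (P.complex.linearYonedaObj R Y).homology n ⟶ ModuleCat.of R (Abelian.Ext N Y n) :=
  ((P.complex.linearYonedaObj R Y).sc n).descHomology (ModuleCat.ofHom (cyclesToExt P Y n))
    (toCycles_comp_cyclesToExt P Y _ n)

lemma homologyπ_homologyToExt {N : ModuleCat.{u} R} (P : ProjectiveResolution N)
    (Y : ModuleCat.{u} R) (n : ℕ) :
    (P.complex.linearYonedaObj R Y).homologyπ n ≫ homologyToExt P Y n = ModuleCat.ofHom (cyclesToExt P Y n) :=
  ShortComplex.π_descHomology _ _ _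

lemma homologyToExt_bijective {N : ModuleCat.{u} R} (P : ProjectiveResolution N)
    (Y : ModuleCat.{u} R) (n : ℕ) : Function.Bijective (homologyToExt P Y n) := by
  constructor
  · rw [← LinearMap.ker_eq_bot (f := (homologyToExt P Y n).hom), LinearMap.ker_eq_bot']
    intro c hc
    obtain ⟨z, rfl⟩ := (ModuleCat.epi_iff_surjective
      ((P.complex.linearYonedaObj R Y).homologyπ n)).1 inferInstance c
    have h := homologyπ_homologyToExt P Y n
    obtain ⟨m, g, rfl⟩ := exists_toCycles_eq P Y n z (congr($h z).symm.trans hc)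
    exact congr($((P.complex.linearYonedaObj R Y).toCycles_comp_homologyπ m n) g)
  · intro c
    obtain ⟨z, rfl⟩ := cyclesToExt_surjective P Y n c
    exact ⟨(P.complex.linearYonedaObj R Y).homologyπ n z,
      congr($(homologyπ_homologyToExt P Y n) z)⟩

/-- `isoExt` followed by the comparison with `Abelian.Ext`. -/
noncomputable def extIso (N Y : ModuleCat.{u} R) (n : ℕ) :
    ((_root_.Ext R (ModuleCat.{u} R) n).obj (Opposite.op N)).obj Y ≅
      ModuleCat.of R (Abelian.Ext N Y n) :=
  (projectiveResolution N).isoExt n Y ≪≫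
    (LinearEquiv.ofBijective (homologyToExt (projectiveResolution N) Y n).hom
      (homologyToExt_bijective _ Y n)).toModuleIso

/-- The map induced by a morphism of resolutions on complexes of morphisms. -/
noncomputable def linearYonedaMap {K L : ChainComplex (ModuleCat.{u} R) ℕ} (φ : K ⟶ L)
    (Y : ModuleCat.{u} R) : L.linearYonedaObj R Y ⟶ K.linearYonedaObj R Y :=
  (HomologicalComplex.unopFunctor _ _).map
    ((((linearYoneda R (ModuleCat.{u} R)).obj Y).rightOp.mapHomologicalComplex _).map φ).op

lemma comp_inv_eq_inv_comp {C : Type*} [Category* C] {A B A' B' : C} (α : A ≅ B) (β : A' ≅ B')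
    (b : B ⟶ B') (a : A ⟶ A') (h : α.hom ≫ b = a ≫ β.hom) : b ≫ β.inv = α.inv ≫ a := by
  rw [Iso.comp_inv_eq, Category.assoc, Iso.eq_inv_comp, h]

lemma homologyUnop_inv_naturality {ι : Type*} {c : ComplexShape ι}
    {K L : HomologicalComplex (ModuleCat.{u} R)ᵒᵖ c} (χ : K ⟶ L) (i : ι) :
    (homologyMap χ i).unop ≫ (homologyUnop K i).inv =
      (homologyUnop L i).inv ≫ homologyMap ((unopFunctor _ _).map χ.op) i := by
  have h := homologyOp_hom_naturality ((unopFunctor _ _).map χ.op) i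
  exact comp_inv_eq_inv_comp (homologyUnop L i) (homologyUnop K i) _ _ congr(Quiver.Hom.unop $h)

lemma isoExt_naturality {N N' : ModuleCat.{u} R} (f : N' ⟶ N) (P : ProjectiveResolution N)
    (Q : ProjectiveResolution N') (φ : Q.complex ⟶ P.complex)
    (comm : φ.f 0 ≫ P.π.f 0 = Q.π.f 0 ≫ f) (Y : ModuleCat.{u} R) (n : ℕ) :
    ((_root_.Ext R (ModuleCat.{u} R) n).map f.op).app Y ≫ (Q.isoExt n Y).hom =
      (P.isoExt n Y).hom ≫ homologyMap (linearYonedaMap φ Y) n := by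
  have h := congr(Quiver.Hom.unop $(ProjectiveResolution.isoLeftDerivedObj_inv_naturality f Q P φ
    comm ((linearYoneda R (ModuleCat.{u} R)).obj Y).rightOp n))
  have h2 := homologyUnop_inv_naturality
    ((((linearYoneda R (ModuleCat.{u} R)).obj Y).rightOp.mapHomologicalComplex _).map φ) n
  refine (Category.assoc _ _ _).symm.trans ?_
  refine (congr($h ≫ (homologyUnop _ n).inv)).trans ?_
  refine (Category.assoc _ _ _).trans ?_
  refine (congr(_ ≫ $h2)).trans ?_
  exact (Category.assoc _ _ _).symm

lemma cyclesToExt_cyclesMap {N N' : ModuleCat.{u} R} (f : N' ⟶ N) (P : ProjectiveResolution N)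
    (Q : ProjectiveResolution N') (φ : Q.complex ⟶ P.complex)
    (comm : φ.f 0 ≫ P.π.f 0 = Q.π.f 0 ≫ f) (Y : ModuleCat.{u} R) (n : ℕ)
    (z : (P.complex.linearYonedaObj R Y).cycles n) :
    cyclesToExt Q Y n (cyclesMap (linearYonedaMap φ Y) n z) =
      (Abelian.Ext.mk₀ f).comp (cyclesToExt P Y n z) (zero_add n) := by
  have h : cocycleHom Q Y n (cyclesMap (linearYonedaMap φ Y) n z) = φ.f n ≫ cocycleHom P Y n z :=
    congr($(cyclesMap_i (linearYonedaMap φ Y) n) z)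
  refine Eq.trans ?_ (ProjectiveResolution.mk₀_comp_extMk (cocycleHom P Y n z) (n + 1) rfl
    (d_comp_cocycleHom P Y n z) (⟨φ, comm⟩ : ProjectiveResolution.Hom Q P f)).symm
  change Q.extMk (cocycleHom Q Y n _) (n + 1) rfl (d_comp_cocycleHom Q Y n _) = _
  congr 1

lemma homologyToExt_naturality {N N' : ModuleCat.{u} R} (f : N' ⟶ N) (P : ProjectiveResolution N)
    (Q : ProjectiveResolution N') (φ : Q.complex ⟶ P.complex)
    (comm : φ.f 0 ≫ P.π.f 0 = Q.π.f 0 ≫ f) (Y : ModuleCat.{u} R) (n : ℕ) :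
    homologyMap (linearYonedaMap φ Y) n ≫ homologyToExt Q Y n =
      homologyToExt P Y n ≫ ModuleCat.ofHom
        ((Abelian.Ext.mk₀ f).precompOfLinear R Y (zero_add n)) := by
  rw [← cancel_epi ((P.complex.linearYonedaObj R Y).homologyπ n),
    homologyπ_naturality_assoc, homologyπ_homologyToExt, ← Category.assoc,
    homologyπ_homologyToExt]
  ext z
  exact cyclesToExt_cyclesMap f P Q φ comm Y n z

lemma extIso_naturality {N N' : ModuleCat.{u} R} (f : N' ⟶ N) (Y : ModuleCat.{u} R) (n : ℕ) :
    ((_root_.Ext R (ModuleCat.{u} R) n).map f.op).app Y ≫ (extIso N' Y n).hom =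
      (extIso N Y n).hom ≫ ModuleCat.ofHom
        ((Abelian.Ext.mk₀ f).precompOfLinear R Y (zero_add n)) := by
  let P := projectiveResolution N
  let Q := projectiveResolution N'
  let φ := ProjectiveResolution.lift f Q P
  have comm : φ.f 0 ≫ P.π.f 0 = Q.π.f 0 ≫ f :=
    ProjectiveResolution.lift_commutes_zero f Q P
  change _ ≫ (Q.isoExt n Y).hom ≫ homologyToExt Q Y n =
    ((P.isoExt n Y).hom ≫ homologyToExt P Y n) ≫ _
  rw [← Category.assoc, isoExt_naturality f P Q φ comm, Category.assoc, Category.assoc,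
    homologyToExt_naturality f P Q φ comm]

end ExtComparison

namespace ModuleExt

variable {R : Type u} [CommRing R]

section Maps

variable {K X Y : Type u} [AddCommGroup K] [Module R K] [AddCommGroup X] [Module R X]
  [AddCommGroup Y] [Module R Y]

/-- The map induced on `Ext` modules by a linear map in the second variable. -/
noncomputable def map (N : ModuleCat.{u} R) (f : X →ₗ[R] Y) (i : ℕ) :
    Abelian.Ext N (ModuleCat.of R X) i →ₗ[R] Abelian.Ext N (ModuleCat.of R Y) i :=
  (Abelian.Ext.mk₀ (ModuleCat.ofHom f)).postcompOfLinear R N (add_zero i)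

lemma map_apply (N : ModuleCat.{u} R) (f : X →ₗ[R] Y) (i : ℕ)
    (c : Abelian.Ext N (ModuleCat.of R X) i) :
    map N f i c = c.comp (Abelian.Ext.mk₀ (ModuleCat.ofHom f)) (add_zero i) := rfl

lemma map_hom_comp (N : ModuleCat.{u} R) (f : K →ₗ[R] X) (g : X →ₗ[R] Y) (i : ℕ) :
    map N (g ∘ₗ f) i = map N g i ∘ₗ map N f i := by
  ext c
  simp [map_apply, ModuleCat.ofHom_comp]

lemma map_hom_id (N : ModuleCat.{u} R) (i : ℕ) : map N (LinearMap.id : X →ₗ[R] X) i = .id := by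
  ext c
  simp [map_apply]

lemma map_hom_smul (N : ModuleCat.{u} R) (r : R) (f : X →ₗ[R] Y) (i : ℕ) :
    map N (r • f) i = r • map N f i := by
  ext c
  have h : ModuleCat.ofHom (r • f) = r • ModuleCat.ofHom f := rfl
  simp [map_apply, h, Abelian.Ext.mk₀_smul]

lemma map_hom_zero (N : ModuleCat.{u} R) (i : ℕ) : map N (0 : X →ₗ[R] Y) i = 0 := by
  ext c
  simp [map_apply]

/-- A linear equivalence induces a linear equivalence on `Ext` modules. -/
noncomputable def congr (N : ModuleCat.{u} R) (e : X ≃ₗ[R] Y) (i : ℕ) :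
    Abelian.Ext N (ModuleCat.of R X) i ≃ₗ[R] Abelian.Ext N (ModuleCat.of R Y) i :=
  LinearEquiv.ofLinearMap (map N e.toLinearMap i) (map N e.symm.toLinearMap i)
    (by rw [← map_hom_comp, LinearEquiv.comp_symm, map_hom_id])
    (by rw [← map_hom_comp, LinearEquiv.symm_comp, map_hom_id])

variable {f : K →ₗ[R] X} {g : X →ₗ[R] Y}

lemma shortExact (hf : Function.Injective f) (hfg : Function.Exact f g)
    (hg : Function.Surjective g) :
    (ShortComplex.mk (ModuleCat.ofHom f) (ModuleCat.ofHom g) (by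
      ext x; exact hfg.apply_apply_eq_zero x)).ShortExact :=
  ModuleCat.shortComplex_shortExact _ hfg hf hg

/-- The connecting map of the long exact sequence of `Ext` modules. -/
noncomputable def δ (N : ModuleCat.{u} R) (hf : Function.Injective f) (hfg : Function.Exact f g)
    (hg : Function.Surjective g) (i : ℕ) :
    Abelian.Ext N (ModuleCat.of R Y) i →ₗ[R] Abelian.Ext N (ModuleCat.of R K) (i + 1) :=
  (shortExact hf hfg hg).extClass.postcompOfLinear R N rfl

lemma δ_apply (N : ModuleCat.{u} R) (hf : Function.Injective f) (hfg : Function.Exact f g)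
    (hg : Function.Surjective g) (i : ℕ) (c : Abelian.Ext N (ModuleCat.of R Y) i) :
    δ N hf hfg hg i c = c.comp (shortExact hf hfg hg).extClass rfl := rfl

lemma exact_map_map (N : ModuleCat.{u} R) (hf : Function.Injective f) (hfg : Function.Exact f g)
    (hg : Function.Surjective g) (i : ℕ) : Function.Exact (map N f i) (map N g i) := by
  refine fun c => ⟨fun h => Abelian.Ext.covariant_sequence_exact₂ N (shortExact hf hfg hg) c h, ?_⟩
  rintro ⟨b, rfl⟩
  rw [← LinearMap.comp_apply, ← map_hom_comp, hfg.linearMap_comp_eq_zero, map_hom_zero]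
  rfl

lemma exact_map_δ (N : ModuleCat.{u} R) (hf : Function.Injective f) (hfg : Function.Exact f g)
    (hg : Function.Surjective g) (i : ℕ) : Function.Exact (map N g i) (δ N hf hfg hg i) := by
  refine fun c =>
    ⟨fun h => Abelian.Ext.covariant_sequence_exact₃ N (shortExact hf hfg hg) c rfl h, ?_⟩
  rintro ⟨b, rfl⟩
  rw [map_apply, δ_apply]
  rw [Abelian.Ext.comp_assoc_of_second_deg_zero]
  exact (congrArg (fun t => b.comp t rfl) ((shortExact hf hfg hg).comp_extClass)).trans
    (Abelian.Ext.comp_zero _ _ _ _ _)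

lemma exact_δ_map (N : ModuleCat.{u} R) (hf : Function.Injective f) (hfg : Function.Exact f g)
    (hg : Function.Surjective g) (i : ℕ) : Function.Exact (δ N hf hfg hg i) (map N f (i + 1)) := by
  refine fun c =>
    ⟨fun h => Abelian.Ext.covariant_sequence_exact₁ N (shortExact hf hfg hg) c h rfl, ?_⟩
  rintro ⟨b, rfl⟩
  rw [map_apply, δ_apply]
  rw [Abelian.Ext.comp_assoc_of_third_deg_zero]
  exact (congrArg (fun t => b.comp t rfl) ((shortExact hf hfg hg).extClass_comp)).trans
    (Abelian.Ext.comp_zero _ _ _ _ _)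

lemma map_injective_zero (N : ModuleCat.{u} R) (hf : Function.Injective f) :
    Function.Injective (map N f 0) := by
  have : Mono (ModuleCat.ofHom f) := (ModuleCat.mono_iff_injective _).2 hf
  exact Abelian.Ext.postcomp_mk₀_injective_of_mono N (ModuleCat.ofHom f)

end Maps

end ModuleExt

/-- `Ext^i_R(R/𝔞, X)` is a finitely generated module. -/
def ExtFinite {R : Type u} [CommRing R] (𝔞 : Ideal R) (X : Type u) [AddCommGroup X] [Module R X]
    (i : ℕ) : Prop :=
  Module.Finite R (Abelian.Ext (ModuleCat.of R (R ⧸ 𝔞)) (ModuleCat.of R X) i)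

namespace ExtFinite

variable {R : Type u} [CommRing R] {𝔞 : Ideal R}

lemma smul_ext_eq_zero {r : R} (hr : r ∈ 𝔞) (X : ModuleCat.{u} R) (i : ℕ)
    (c : Abelian.Ext (ModuleCat.of R (R ⧸ 𝔞)) X i) : r • c = 0 := by
  have h : r • 𝟙 (ModuleCat.of R (R ⧸ 𝔞)) = 0 := by
    ext
    change r • (Submodule.Quotient.mk 1 : R ⧸ 𝔞) = 0
    rw [← Submodule.Quotient.mk_smul,
      Submodule.Quotient.mk_eq_zero]
    simpa using hr
  rw [← c.mk₀_id_comp, ← Abelian.Ext.smul_comp, ← Abelian.Ext.mk₀_smul, h, Abelian.Ext.mk₀_zero,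
    Abelian.Ext.zero_comp]

variable {K X Y : Type u} [AddCommGroup K] [Module R K] [AddCommGroup X] [Module R X]
  [AddCommGroup Y] [Module R Y]

lemma congr (e : X ≃ₗ[R] Y) {i : ℕ} (h : ExtFinite 𝔞 X i) : ExtFinite 𝔞 Y i :=
  have : Module.Finite R _ := h
  Module.Finite.equiv (ModuleExt.congr _ e i)

lemma torsionBySet_fg (h : ExtFinite 𝔞 X 0) : (Submodule.torsionBySet R X (𝔞 : Set R)).FG := by
  have : Module.Finite R _ := h
  have : Module.Finite R ((R ⧸ 𝔞) →ₗ[R] X) :=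
    Module.Finite.equiv ((Abelian.Ext.linearEquiv₀ (R := R)).trans
      (ModuleCat.homLinearEquiv (M := ModuleCat.of R (R ⧸ 𝔞)) (N := ModuleCat.of R X) (S := R)))
  let e : ((R ⧸ 𝔞) →ₗ[R] X) →ₗ[R] X := LinearMap.applyₗ 1
  have hle : Submodule.torsionBySet R X (𝔞 : Set R) ≤ LinearMap.range e := by
    intro m hm
    rw [Submodule.mem_torsionBySet_iff] at hm
    refine ⟨Submodule.liftQ 𝔞 (LinearMap.toSpanSingleton R X m) fun r hr => ?_, ?_⟩
    · simpa using hm ⟨r, hr⟩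
    · change LinearMap.toSpanSingleton R X m 1 = m
      exact one_smul R m
  have hge : LinearMap.range e ≤ Submodule.torsionBySet R X (𝔞 : Set R) := by
    rintro _ ⟨φ, rfl⟩
    rw [Submodule.mem_torsionBySet_iff]
    rintro ⟨r, hr⟩
    change r • φ (Submodule.Quotient.mk 1) = 0
    rw [← LinearMap.map_smul, ← Submodule.Quotient.mk_smul,
      (Submodule.Quotient.mk_eq_zero _).2 (by simpa using hr), LinearMap.map_zero]
  rw [le_antisymm hle hge, LinearMap.range_eq_map]
  exact Module.Finite.fg_top.map e

variable [IsNoetherianRing R]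

lemma finite_of_exact {A B C : Type*} [AddCommGroup A] [Module R A] [AddCommGroup B]
    [Module R B] [AddCommGroup C] [Module R C] {f : A →ₗ[R] B} {g : B →ₗ[R] C}
    (h : Function.Exact f g) [Module.Finite R A] [Module.Finite R C] : Module.Finite R B := by
  refine Module.Finite.of_exact (f := f) (g := g.rangeRestrict) (fun b => ?_)
    g.surjective_rangeRestrict
  rw [← h b]
  exact Subtype.ext_iff

lemma finite_of_exact_of_comp {A B C D : Type*} [AddCommGroup A] [Module R A] [AddCommGroup B]
    [Module R B] [AddCommGroup C] [Module R C] [AddCommGroup D] [Module R D] {f : A →ₗ[R] B}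
    {g : B →ₗ[R] C} (h : Function.Exact f g) {k : C →ₗ[R] D} (hk : k ∘ₗ g = 0)
    [Module.Finite R A] [Module.Finite R (LinearMap.ker k)] : Module.Finite R B := by
  refine finite_of_exact (f := f)
    (g := g.codRestrict (LinearMap.ker k) fun c => LinearMap.congr_fun hk c) fun b => ?_
  rw [← h b]
  exact Subtype.ext_iff

lemma of_finite [Module.Finite R X] (i : ℕ) : ExtFinite 𝔞 X i :=
  ModuleCat.finite_ext R (ModuleCat.of R (R ⧸ 𝔞)) (ModuleCat.of R X) i

lemma zero_of_injective {f : K →ₗ[R] X} (hf : Function.Injective f) (h : ExtFinite 𝔞 X 0) :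
    ExtFinite 𝔞 K 0 :=
  have : Module.Finite R _ := h
  Module.Finite.of_injective _ (ModuleExt.map_injective_zero (ModuleCat.of R (R ⧸ 𝔞)) hf)

variable {f : K →ₗ[R] X} {g : X →ₗ[R] Y}

lemma middle (hf : Function.Injective f) (hfg : Function.Exact f g) (hg : Function.Surjective g)
    {i : ℕ} (hK : ExtFinite 𝔞 K i) (hY : ExtFinite 𝔞 Y i) : ExtFinite 𝔞 X i :=
  have : Module.Finite R _ := hK
  have : Module.Finite R _ := hY
  finite_of_exact (ModuleExt.exact_map_map _ hf hfg hg i)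

lemma right (hf : Function.Injective f) (hfg : Function.Exact f g) (hg : Function.Surjective g)
    {i : ℕ} (hX : ExtFinite 𝔞 X i) (hK : ExtFinite 𝔞 K (i + 1)) : ExtFinite 𝔞 Y i :=
  have : Module.Finite R _ := hX
  have : Module.Finite R _ := hK
  finite_of_exact (ModuleExt.exact_map_δ _ hf hfg hg i)

lemma left (hf : Function.Injective f) (hfg : Function.Exact f g) (hg : Function.Surjective g)
    {i : ℕ} (hY : ExtFinite 𝔞 Y i) (hX : ExtFinite 𝔞 X (i + 1)) : ExtFinite 𝔞 K (i + 1) :=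
  have : Module.Finite R _ := hY
  have : Module.Finite R _ := hX
  finite_of_exact (ModuleExt.exact_δ_map _ hf hfg hg i)

/-- The finiteness of all `Ext^i_R(R/𝔞, X)` follows from the same for the kernel and cokernel of
multiplication by an element of `𝔞`. -/
lemma of_ker_of_coker {x : R} (hx : x ∈ 𝔞)
    (hK : ∀ i, ExtFinite 𝔞 (LinearMap.ker (LinearMap.lsmul R X x)) i)
    (hC : ∀ i, ExtFinite 𝔞 (X ⧸ LinearMap.range (LinearMap.lsmul R X x)) i) (i : ℕ) :
    ExtFinite 𝔞 X i := by
  set μ := LinearMap.lsmul R X x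
  let N := ModuleCat.of R (R ⧸ 𝔞)
  have hp : Function.Exact (LinearMap.ker μ).subtype μ.rangeRestrict := by
    rw [LinearMap.exact_iff, LinearMap.ker_rangeRestrict, Submodule.range_subtype]
  have hj : Function.Exact (LinearMap.range μ).subtype (LinearMap.range μ).mkQ := by
    rw [LinearMap.exact_iff, Submodule.ker_mkQ, Submodule.range_subtype]
  have hcomp : ModuleExt.map N (LinearMap.range μ).subtype i ∘ₗ
      ModuleExt.map N μ.rangeRestrict i = 0 := by
    rw [← ModuleExt.map_hom_comp, LinearMap.subtype_comp_codRestrict]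
    have hμ : μ = x • LinearMap.id := by ext; rfl
    rw [hμ, ModuleExt.map_hom_smul, ModuleExt.map_hom_id]
    ext c
    exact smul_ext_eq_zero hx _ _ c
  have hfin : Module.Finite R (LinearMap.ker (ModuleExt.map N (LinearMap.range μ).subtype i)) := by
    cases i with
    | zero =>
      rw [LinearMap.ker_eq_bot.2
        (ModuleExt.map_injective_zero N (LinearMap.range μ).injective_subtype)]
      infer_instance
    | succ i =>
      rw [(ModuleExt.exact_δ_map N (LinearMap.range μ).injective_subtype hj
        (Submodule.mkQ_surjective _) i).linearMap_ker_eq]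
      have : Module.Finite R _ := hC i
      infer_instance
  have : Module.Finite R _ := hK i
  have hex := ModuleExt.exact_map_map N (LinearMap.ker μ).injective_subtype hp
    μ.surjective_rangeRestrict i
  exact finite_of_exact_of_comp hex hcomp

lemma torsionBySet_pow_fg (h : (Submodule.torsionBySet R X (𝔞 : Set R)).FG) (n : ℕ) :
    (Submodule.torsionBySet R X ((𝔞 ^ n : Ideal R) : Set R)).FG := by
  induction n with
  | zero =>
    convert Submodule.fg_bot
    rw [eq_bot_iff]
    intro m hm
    simpa using (Submodule.mem_torsionBySet_iff _ _).1 hm ⟨1, by simp⟩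
  | succ n ih =>
    obtain ⟨S, hS⟩ := (isNoetherianRing_iff_ideal_fg R).1 inferInstance 𝔞
    let φ : X →ₗ[R] (S → X) := LinearMap.pi fun s => LinearMap.lsmul R X s
    refine Submodule.fg_of_fg_map_of_fg_inf_ker φ ?_ ?_
    · refine (Submodule.fg_pi (fun _ : S => ih)).of_le ?_
      rintro _ ⟨m, hm, rfl⟩ s -
      refine (Submodule.mem_torsionBySet_iff _ _).2 ?_
      rintro ⟨r, hr⟩
      have := (Submodule.mem_torsionBySet_iff _ _).1 hm ⟨r * s, by
        rw [SetLike.mem_coe, pow_succ]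
        exact Ideal.mul_mem_mul hr (hS ▸ Ideal.subset_span s.2)⟩
      change r • ((s : R) • m) = 0
      rwa [← mul_smul]
    · refine h.of_le ?_
      rintro m ⟨-, hm⟩
      rw [Submodule.mem_torsionBySet_iff]
      have hle : 𝔞 ≤ LinearMap.ker (LinearMap.toSpanSingleton R X m) := by
        rw [← hS, Ideal.span_le]
        intro s hs
        exact congrFun hm ⟨s, hs⟩
      rintro ⟨r, hr⟩
      exact hle hr

lemma finite_of_le_radical (h : ExtFinite 𝔞 X 0) (hr : 𝔞 ≤ (Module.annihilator R X).radical) :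
    Module.Finite R X := by
  obtain ⟨n, hn⟩ := Ideal.exists_pow_le_of_le_radical_of_fg hr
    ((isNoetherianRing_iff_ideal_fg R).1 inferInstance 𝔞)
  refine ⟨?_⟩
  convert torsionBySet_pow_fg h.torsionBySet_fg n
  symm
  rw [eq_top_iff]
  intro m _
  rw [Submodule.mem_torsionBySet_iff]
  rintro ⟨r, hr⟩
  exact Module.mem_annihilator.1 (hn hr) m

end ExtFinite

/-- A dévissage principle: to show that all `Ext^i_R(R/𝔞, X)` are finitely generated for the
modules `X` in a class, it suffices to be able to treat the kernel of some power of each element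
`x ∈ 𝔞` and the kernel and cokernel of `x` on the quotient by it. -/
lemma ExtFinite.of_devissage {R : Type u} [CommRing R] [IsNoetherianRing R] {𝔞 : Ideal R}
    (P : ∀ (X : Type u) [AddCommGroup X] [Module R X], Prop)
    (h0 : ∀ (X : Type u) [AddCommGroup X] [Module R X], P X → ExtFinite 𝔞 X 0)
    (h1 : ∀ (X : Type u) [AddCommGroup X] [Module R X], P X → ∀ x ∈ 𝔞, ∃ k : ℕ,
      P (LinearMap.ker (LinearMap.lsmul R X (x ^ k))) ∧
      ((∀ i, ExtFinite 𝔞 (LinearMap.ker (LinearMap.lsmul R X (x ^ k))) i) →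
        P (LinearMap.ker (LinearMap.lsmul R (X ⧸ LinearMap.ker (LinearMap.lsmul R X (x ^ k))) x)) ∧
        ((∀ i, ExtFinite 𝔞 (LinearMap.ker
            (LinearMap.lsmul R (X ⧸ LinearMap.ker (LinearMap.lsmul R X (x ^ k))) x)) i) →
          ∀ i, ExtFinite 𝔞 ((X ⧸ LinearMap.ker (LinearMap.lsmul R X (x ^ k))) ⧸ LinearMap.range
            (LinearMap.lsmul R (X ⧸ LinearMap.ker (LinearMap.lsmul R X (x ^ k))) x)) i)))
    (X : Type u) [AddCommGroup X] [Module R X] (hX : P X) (i : ℕ) : ExtFinite 𝔞 X i := by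
  classical
  obtain ⟨S, hS⟩ := (isNoetherianRing_iff_ideal_fg R).1 inferInstance 𝔞
  suffices H : ∀ (s : Finset R) (X : Type u) [AddCommGroup X] [Module R X], P X →
      (∀ y ∈ S, y ∉ s → y ∈ (Module.annihilator R X).radical) → ∀ i, ExtFinite 𝔞 X i from
    H S X hX (fun y hy hy' => absurd hy hy') i
  intro s
  induction s using Finset.induction_on with
  | empty =>
    intro X _ _ hX hs i
    have : Module.Finite R X := (h0 X hX).finite_of_le_radical (by
      rw [← hS, Ideal.span_le]
      exact fun y hy => hs y hy (by simp))
    exact of_finite i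
  | insert x s hxs ih =>
    intro X _ _ hX hs
    have key : ∀ (Z : Type u) [AddCommGroup Z] [Module R Z], P Z →
        Module.annihilator R X ≤ Module.annihilator R Z →
        x ∈ (Module.annihilator R Z).radical → ∀ i, ExtFinite 𝔞 Z i := by
      intro Z _ _ hZ hann hx
      refine ih Z hZ fun y hy hys => ?_
      by_cases hyx : y = x
      · exact hyx ▸ hx
      · exact Ideal.radical_mono hann (hs y hy (by simp [hyx, hys]))
    by_cases hxa : x ∈ 𝔞
    · obtain ⟨k, hPK, hk⟩ := h1 X hX x hxa
      set K := LinearMap.ker (LinearMap.lsmul R X (x ^ k))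
      have hK : ∀ i, ExtFinite 𝔞 K i := by
        refine key K hPK (LinearMap.annihilator_le_of_injective _ K.injective_subtype)
          ⟨k, Module.mem_annihilator.2 fun m => Subtype.ext m.2⟩
      obtain ⟨hPL, hL⟩ := hk hK
      have hL' := key _ hPL
        ((LinearMap.annihilator_le_of_surjective K.mkQ K.mkQ_surjective).trans
          (LinearMap.annihilator_le_of_injective _ (Submodule.injective_subtype _)))
        (Ideal.le_radical (Module.mem_annihilator.2 fun m => Subtype.ext m.2))
      have hY := of_ker_of_coker hxa hL' (hL hL')
      intro i
      refine middle (f := K.subtype) (g := K.mkQ) K.injective_subtype ?_ K.mkQ_surjective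
        (hK i) (hY i)
      rw [LinearMap.exact_iff, Submodule.ker_mkQ, Submodule.range_subtype]
    · refine ih X hX fun y hy hys => hs y hy ?_
      have : y ≠ x := by
        rintro rfl
        exact hxa (hS ▸ Ideal.subset_span hy)
      simp [this, hys]

lemma isArtinian_of_ker_lsmul {R M : Type*} [CommRing R] [AddCommGroup M] [Module R M] (x : R)
    (h : ∀ m : M, ∃ n : ℕ, x ^ n • m = 0) [IsArtinian R (LinearMap.ker (LinearMap.lsmul R M x))] :
    IsArtinian R M := by
  set K := LinearMap.ker (LinearMap.lsmul R M x)
  let F (Z : Submodule R M) (n : ℕ) : Submodule R K :=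
    (Z.map (LinearMap.lsmul R M (x ^ n))).comap K.subtype
  have hF (Z n) (m : K) : m ∈ F Z n ↔ ∃ z ∈ Z, x ^ n • z = m := Iff.rfl
  have mono {Y Z : Submodule R M} (hYZ : Y ≤ Z) {m n : ℕ} (hmn : m ≤ n) : F Y n ≤ F Z m := by
    intro k hk
    rw [hF] at hk ⊢
    obtain ⟨z, hz, hzk⟩ := hk
    refine ⟨x ^ (n - m) • z, hYZ (Y.smul_mem _ hz), ?_⟩
    rw [← mul_smul, ← pow_add, Nat.add_sub_cancel' hmn, hzk]
  have eq_of {Y Z : Submodule R M} (hYZ : Y ≤ Z) (hn : ∀ n, F Z n ≤ F Y n) : Y = Z := by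
    refine le_antisymm hYZ fun z hz => ?_
    obtain ⟨n, hzn⟩ := h z
    induction n generalizing z with
    | zero =>
      rw [pow_zero, one_smul] at hzn
      exact hzn ▸ Y.zero_mem
    | succ n ih =>
      have hk : x ^ n • z ∈ K := by
        change x • x ^ n • z = 0
        rwa [← mul_smul, ← pow_succ']
      obtain ⟨y, hy, hyz⟩ := (hF _ _ _).1 (hn n ((hF Z n ⟨_, hk⟩).2 ⟨z, hz, rfl⟩))
      have := ih (z - y) (Z.sub_mem hz (hYZ hy)) (by rw [smul_sub, hyz, sub_self])
      simpa using Y.add_mem this hy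
  rw [← monotone_stabilizes_iff_artinian]
  intro f
  have hf {i j : ℕ} (hij : i ≤ j) : OrderDual.ofDual (f j) ≤ OrderDual.ofDual (f i) :=
    f.monotone hij
  have stab (g : ℕ → ℕ) (hg : Monotone g) : ∃ n, ∀ m, n ≤ m →
      F (OrderDual.ofDual (f n)) (g n) = F (OrderDual.ofDual (f m)) (g m) :=
    IsArtinian.monotone_stabilizes (R := R) (M := K)
      ⟨fun n => OrderDual.toDual (F (OrderDual.ofDual (f n)) (g n)),
        fun i j hij => mono (hf hij) (hg hij)⟩
  obtain ⟨d, hd⟩ := stab id monotone_id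
  choose c hc using fun n : ℕ => stab (fun _ => n) monotone_const
  refine ⟨d + ∑ n ∈ Finset.range d, c n, fun m hm => ?_⟩
  refine (eq_of (hf hm) fun n => ?_).symm
  by_cases hn : n < d
  · have hcn : c n ≤ d + ∑ n ∈ Finset.range d, c n :=
      (Finset.single_le_sum (f := c) (fun _ _ => Nat.zero_le _)
        (Finset.mem_range.2 hn)).trans (Nat.le_add_left _ _)
    exact ((hc n _ hcn).symm.trans (hc n m (hcn.trans hm))).le
  · push Not at hn
    calc _ ≤ F (OrderDual.ofDual (f d)) d := mono (hf (Nat.le_add_right _ _)) hn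
      _ = F (OrderDual.ofDual (f (max m n))) (max m n) := hd _ (hn.trans (le_max_right _ _))
      _ ≤ _ := mono (hf (le_max_left _ _)) (le_max_right _ _)

lemma isArtinian_of_torsionBySet {R M : Type*} [CommRing R] [AddCommGroup M] [Module R M]
    (S : Finset R) (h : ∀ s ∈ S, ∀ m : M, ∃ n : ℕ, s ^ n • m = 0)
    [IsArtinian R (Submodule.torsionBySet R M (S : Set R))] : IsArtinian R M := by
  classical
  suffices H : ∀ (S T : Finset R), (∀ s ∈ S, ∀ m : M, ∃ n : ℕ, s ^ n • m = 0) →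
      IsArtinian R (Submodule.torsionBySet R M ((S ∪ T : Finset R) : Set R)) →
      IsArtinian R (Submodule.torsionBySet R M (T : Set R)) by
    have := H S ∅ h (by rwa [Finset.union_empty])
    have htop : Submodule.torsionBySet R M ((∅ : Finset R) : Set R) = ⊤ := by
      rw [eq_top_iff]
      intro m _
      rw [Submodule.mem_torsionBySet_iff]
      rintro ⟨_, h⟩
      simp at h
    rw [htop] at this
    exact isArtinian_of_linearEquiv Submodule.topEquiv
  intro S
  induction S using Finset.induction_on with
  | empty =>
    intro T _ h
    rwa [Finset.empty_union] at h
  | insert x S _ ih =>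
    intro T hT hart
    have := ih (insert x T) (fun s hs => hT s (Finset.mem_insert_of_mem hs))
      (by rwa [Finset.union_insert, ← Finset.insert_union])
    set Z := Submodule.torsionBySet R M (T : Set R)
    have hker : IsArtinian R (LinearMap.ker (LinearMap.lsmul R Z x)) := by
      refine isArtinian_of_injective (P := Submodule.torsionBySet R M
        ((insert x T : Finset R) : Set R)) ((Z.subtype ∘ₗ Submodule.subtype _).codRestrict _ ?_) ?_
      · rintro ⟨⟨m, hm⟩, hx⟩
        rw [Submodule.mem_torsionBySet_iff]
        rintro ⟨r, hr⟩
        rcases Finset.mem_insert.1 hr with rfl | hr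
        · exact congrArg Subtype.val hx
        · exact (Submodule.mem_torsionBySet_iff _ _).1 hm ⟨r, hr⟩
      · intro a b hab
        exact Subtype.ext (Subtype.ext (Subtype.ext_iff.1 hab :))
    refine isArtinian_of_ker_lsmul x fun m => ?_
    obtain ⟨n, hn⟩ := hT x (Finset.mem_insert_self _ _) m
    exact ⟨n, Subtype.ext hn⟩

lemma isArtinian_of_finite_of_forall_isMaximal {R M : Type*} [CommRing R] [IsNoetherianRing R]
    [AddCommGroup M] [Module R M] [Module.Finite R M]
    (h : ∀ p : Ideal R, p.IsPrime → Module.annihilator R M ≤ p → p.IsMaximal) :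
    IsArtinian R M := by
  have : Ring.KrullDimLE 0 (R ⧸ Module.annihilator R M) :=
    Ideal.krullDimLE_zero_quotient_iff_forall_minimalPrimes_isMaximal.2
      fun J hJ => h J hJ.1.1 hJ.1.2
  have : IsArtinianRing (R ⧸ Module.annihilator R M) :=
    IsNoetherianRing.isArtinianRing_of_krullDimLE_zero
  let _ : Module (R ⧸ Module.annihilator R M) M := Module.quotientAnnihilator
  have : Module.Finite (R ⧸ Module.annihilator R M) M :=
    Module.Finite.of_restrictScalars_finite R _ _
  exact isArtinian_of_surjective_algebraMap (R := R ⧸ Module.annihilator R M)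
    Ideal.Quotient.mk_surjective

/-- Every element of the module is killed by a power of each element of the ideal. -/
def Ideal.IsPowTorsion {R : Type*} [CommRing R] (𝔞 : Ideal R) (M : Type*) [AddCommGroup M]
    [Module R M] : Prop :=
  ∀ x ∈ 𝔞, ∀ m : M, ∃ n : ℕ, x ^ n • m = 0

namespace Ideal.IsPowTorsion

variable {R : Type*} [CommRing R] {𝔞 : Ideal R} {M N : Type*} [AddCommGroup M] [Module R M]
  [AddCommGroup N] [Module R N]

lemma of_injective (h : 𝔞.IsPowTorsion N) {f : M →ₗ[R] N} (hf : Function.Injective f) :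
    𝔞.IsPowTorsion M := fun x hx m => by
  obtain ⟨n, hn⟩ := h x hx (f m)
  exact ⟨n, hf (by rw [map_smul, hn, map_zero])⟩

lemma of_surjective (h : 𝔞.IsPowTorsion M) {f : M →ₗ[R] N} (hf : Function.Surjective f) :
    𝔞.IsPowTorsion N := fun x hx m => by
  obtain ⟨m, rfl⟩ := hf m
  obtain ⟨n, hn⟩ := h x hx m
  exact ⟨n, by rw [← map_smul, hn, map_zero]⟩

lemma isArtinian [IsNoetherianRing R] (h : 𝔞.IsPowTorsion M)
    [IsArtinian R (Submodule.torsionBySet R M (𝔞 : Set R))] : IsArtinian R M := by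
  obtain ⟨S, rfl⟩ := (isNoetherianRing_iff_ideal_fg R).1 inferInstance 𝔞
  rw [← Submodule.torsionBySet_eq_torsionBySet_span] at *
  exact isArtinian_of_torsionBySet S fun s hs => h s (Ideal.subset_span hs)

end Ideal.IsPowTorsion

section KerLsmul

variable {R X : Type*} [CommRing R] [AddCommGroup X] [Module R X]

/-- The embedding of the quotient by the kernel of multiplication by `y` given by `y`. -/
def quotKerLsmul (y : R) : (X ⧸ LinearMap.ker (LinearMap.lsmul R X y)) →ₗ[R] X :=
  Submodule.liftQ _ (LinearMap.lsmul R X y) le_rfl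

lemma quotKerLsmul_injective (y : R) : Function.Injective (quotKerLsmul (X := X) y) := by
  rw [← LinearMap.ker_eq_bot, quotKerLsmul, Submodule.ker_liftQ_eq_bot _ _ _ le_rfl]

lemma Submodule.exact_subtype_mkQ (K : Submodule R X) : Function.Exact K.subtype K.mkQ := by
  rw [LinearMap.exact_iff, Submodule.ker_mkQ, Submodule.range_subtype]

end KerLsmul

namespace ExtFinite

variable {R : Type u} [CommRing R] [IsNoetherianRing R] {𝔞 : Ideal R}

lemma of_isArtinian (X : Type u) [AddCommGroup X] [Module R X] [hX : IsArtinian R X]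
    (h : ExtFinite 𝔞 X 0) (i : ℕ) : ExtFinite 𝔞 X i := by
  refine of_devissage (fun X _ _ => IsArtinian R X ∧ ExtFinite 𝔞 X 0) (fun X _ _ h => h.2) ?_ X
    ⟨hX, h⟩ i
  rintro X _ _ ⟨hX, h⟩ x -
  obtain ⟨k, hk⟩ := IsArtinian.range_smul_pow_stabilizes X x
  have hY := zero_of_injective (quotKerLsmul_injective (X := X) (x ^ k)) h
  refine ⟨k, ⟨inferInstance, zero_of_injective (Submodule.injective_subtype _) h⟩, fun _ =>
    ⟨⟨inferInstance, zero_of_injective (Submodule.injective_subtype _) hY⟩, fun _ => ?_⟩⟩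
  set K := LinearMap.ker (LinearMap.lsmul R X (x ^ k))
  have htop : LinearMap.range (LinearMap.lsmul R (X ⧸ K) x) = ⊤ := by
    rw [LinearMap.range_eq_top]
    intro y
    obtain ⟨m, rfl⟩ := K.mkQ_surjective y
    obtain ⟨m', hm'⟩ : x ^ k • m ∈ LinearMap.range (x ^ (k + 1) • LinearMap.id : X →ₗ[R] X) :=
      hk (k + 1) k.le_succ ▸ ⟨m, rfl⟩
    have hm : x ^ (k + 1) • m' = x ^ k • m := hm'
    refine ⟨K.mkQ m', ?_⟩
    rw [LinearMap.lsmul_apply, ← map_smul, ← sub_eq_zero, ← map_sub, ← LinearMap.mem_ker,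
      Submodule.ker_mkQ]
    change x ^ k • (x • m' - m) = 0
    rw [smul_sub, ← mul_smul, ← pow_succ, hm, sub_self]
  have : Subsingleton ((X ⧸ K) ⧸ LinearMap.range (LinearMap.lsmul R (X ⧸ K) x)) :=
    Submodule.Quotient.subsingleton_iff.2 htop
  exact of_finite

lemma of_support_isMaximal {X : Type u} [AddCommGroup X] [Module R X] (ht : 𝔞.IsPowTorsion X)
    (hs : ∀ p ∈ Module.support R X, p.asIdeal.IsMaximal) (h : ExtFinite 𝔞 X 0) (i : ℕ) :
    ExtFinite 𝔞 X i := by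
  set L := Submodule.torsionBySet R X (𝔞 : Set R)
  have : Module.Finite R L := Module.Finite.iff_fg.2 h.torsionBySet_fg
  have : IsArtinian R L := isArtinian_of_finite_of_forall_isMaximal fun p hp hle =>
    hs ⟨p, hp⟩ (Module.support_subset_of_injective _ L.injective_subtype
      (Module.mem_support_iff_of_finite.2 hle))
  have := ht.isArtinian
  exact of_isArtinian X h i

end ExtFinite

lemma mem_support_torsionBySet {R : Type*} [CommRing R] [IsNoetherianRing R] {𝔞 : Ideal R}
    {M : Type*} [AddCommGroup M] [Module R M] (ht : 𝔞.IsPowTorsion M) {p : PrimeSpectrum R}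
    (hp : p ∈ Module.support R M) :
    p ∈ Module.support R (Submodule.torsionBySet R M (𝔞 : Set R)) := by
  obtain ⟨m, hm⟩ := Module.mem_support_iff_exists_annihilator.1 hp
  have := p.2
  obtain ⟨q, hq, hqp⟩ := Ideal.exists_minimalPrimes_le hm
  obtain ⟨hqprime, l, hl⟩ := isAssociatedPrime_iff.1
    (Module.associatedPrimes.minimalPrimes_annihilator_subset_associatedPrimes R _ hq)
  have hlq (r : R) : r ∈ q ↔ r • l = 0 := by
    rw [hl, Submodule.mem_colon_singleton, Submodule.mem_bot]
  have hmem : (l : M) ∈ Submodule.torsionBySet R M (𝔞 : Set R) := by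
    rw [Submodule.mem_torsionBySet_iff]
    rintro ⟨x, hx⟩
    obtain ⟨n, hn⟩ := ht x hx l
    exact congrArg Subtype.val
      ((hlq x).1 (hqprime.mem_of_pow_mem n ((hlq _).2 (Subtype.ext hn))))
  rw [Module.mem_support_iff']
  refine ⟨⟨l, hmem⟩, fun r hr h => hr (hqp ((hlq r).2 (Subtype.ext ?_)))⟩
  exact congrArg (Submodule.subtype _) h

lemma isArtinian_localizedModule {R : Type*} [CommRing R] [IsNoetherianRing R] {𝔞 : Ideal R}
    {M : Type*} [AddCommGroup M] [Module R M] (ht : 𝔞.IsPowTorsion M)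
    (hfg : (Submodule.torsionBySet R M (𝔞 : Set R)).FG) (p : Ideal R) [p.IsPrime]
    (hp : ∀ q : Ideal R, q.IsPrime →
      Module.annihilator R (Submodule.torsionBySet R M (𝔞 : Set R)) ≤ q → q ≤ p → q = p) :
    IsArtinian (Localization p.primeCompl) (LocalizedModule p.primeCompl M) := by
  classical
  obtain ⟨S, hS⟩ := (isNoetherianRing_iff_ideal_fg R).1 inferInstance 𝔞
  set L := Submodule.torsionBySet R M (𝔞 : Set R)
  let R' := Localization p.primeCompl
  let M' := LocalizedModule p.primeCompl M
  have halg (r : R) (m : M) (t : p.primeCompl) :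
      algebraMap R R' r • (LocalizedModule.mk m t : M') = LocalizedModule.mk (r • m) t := by
    rw [algebraMap_smul, LocalizedModule.smul'_mk]
  let S' : Finset R' := S.image (algebraMap R R')
  have hmem (n : M') (hn : n ∈ Submodule.torsionBySet R' M' (S' : Set R')) :
      ∃ (m : M) (t u : p.primeCompl), n = LocalizedModule.mk m t ∧ u • m ∈ L := by
    induction n using LocalizedModule.induction_on with
    | _ m t
    have hs (s : S) : ∃ u : p.primeCompl, u • (s : R) • m = 0 := by
      have := (Submodule.mem_torsionBySet_iff _ _).1 hn
        ⟨algebraMap R R' s, Finset.mem_image_of_mem _ s.2⟩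
      change algebraMap R R' s • _ = _ at this
      rw [halg, ← LocalizedModule.zero_mk 1, LocalizedModule.mk_eq] at this
      obtain ⟨u, hu⟩ := this
      exact ⟨u, by simpa using hu⟩
    choose u hu using hs
    refine ⟨m, t, ∏ s, u s, rfl, ?_⟩
    change _ ∈ Submodule.torsionBySet R M (𝔞 : Set R)
    rw [← hS, ← Submodule.torsionBySet_eq_torsionBySet_span, Submodule.mem_torsionBySet_iff]
    intro s
    obtain ⟨v, hv⟩ := Finset.dvd_prod_of_mem u (Finset.mem_univ s)
    rw [hv, mul_comm, mul_smul, smul_comm, smul_comm (s : R), hu, smul_zero]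
  set N := Submodule.torsionBySet R' M' (S' : Set R')
  have hN : N.FG := by
    obtain ⟨G, hG⟩ := hfg
    refine Submodule.FG.of_le (T := Submodule.span R' (LocalizedModule.mkLinearMap p.primeCompl M ''
      G)) ⟨G.image (LocalizedModule.mkLinearMap p.primeCompl M), by rw [Finset.coe_image]⟩ ?_
    intro n hn
    obtain ⟨m, t, u, rfl, hu⟩ := hmem n hn
    have h1 : LocalizedModule.mkLinearMap p.primeCompl M (u • m) ∈ Submodule.span R'
        (LocalizedModule.mkLinearMap p.primeCompl M '' G) := by
      have h2 : LocalizedModule.mkLinearMap p.primeCompl M (u • m) ∈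
          (Submodule.span R (G : Set M)).map (LocalizedModule.mkLinearMap p.primeCompl M) :=
        Submodule.mem_map_of_mem (hG ▸ hu)
      rw [Submodule.map_span] at h2
      exact Submodule.span_le_restrictScalars R R' _ h2
    have h3 : (LocalizedModule.mk m t : M') = (Localization.mk 1 (t * u) : R') •
        LocalizedModule.mkLinearMap p.primeCompl M (u • m) := by
      rw [LocalizedModule.mkLinearMap_apply, LocalizedModule.mk_smul_mk, one_smul, mul_one,
        LocalizedModule.mk_cancel_common_right]
    rw [h3]
    exact Submodule.smul_mem _ _ h1
  have : Module.Finite R' N := Module.Finite.iff_fg.2 hN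
  have : IsArtinian R' N := by
    refine isArtinian_of_finite_of_forall_isMaximal fun q hq hle => ?_
    have hqp : q.under R = p := by
      refine hp _ inferInstance (fun r hr => hle ?_) fun r hr => ?_
      · rw [Module.mem_annihilator]
        rintro ⟨n, hn⟩
        obtain ⟨m, t, u, rfl, hu⟩ := hmem n hn
        refine Subtype.ext ?_
        change algebraMap R R' r • (LocalizedModule.mk m t : M') = 0
        rw [halg, ← LocalizedModule.zero_mk 1, LocalizedModule.mk_eq]
        refine ⟨u, ?_⟩
        have := congrArg Subtype.val (Module.mem_annihilator.1 hr ⟨_, hu⟩)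
        change r • u • m = 0 at this
        rw [one_smul, smul_comm, this, smul_zero, smul_zero]
      · by_contra hrp
        exact hq.ne_top (Ideal.eq_top_of_isUnit_mem _ hr
          (IsLocalization.map_units R' (⟨r, hrp⟩ : p.primeCompl)))
    rw [Localization.AtPrime.eq_maximalIdeal_iff_under_eq.1 hqp]
    exact IsLocalRing.maximalIdeal.isMaximal _
  refine isArtinian_of_torsionBySet S' ?_
  intro s hs n
  obtain ⟨s, hsS, rfl⟩ := Finset.mem_image.1 hs
  induction n using LocalizedModule.induction_on with
  | _ m t
  obtain ⟨k, hk⟩ := ht s (hS ▸ Ideal.subset_span hsS) m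
  exact ⟨k, by rw [← map_pow, halg, hk, LocalizedModule.zero_mk]⟩

lemma exists_smul_sub_mem_ker_of_isArtinian {R : Type*} [CommRing R] {M : Type*} [AddCommGroup M]
    [Module R M] (p : Ideal R) [p.IsPrime]
    [IsArtinian (Localization p.primeCompl) (LocalizedModule p.primeCompl M)] (x : R) :
    ∃ k : ℕ, ∀ m : M, ∃ s ∉ p, ∃ m' : M, x ^ k • (s • m - x • m') = 0 := by
  let R' := Localization p.primeCompl
  let M' := LocalizedModule p.primeCompl M
  have halg (r : R) (m : M) (t : p.primeCompl) :
      algebraMap R R' r • (LocalizedModule.mk m t : M') = LocalizedModule.mk (r • m) t := by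
    rw [algebraMap_smul, LocalizedModule.smul'_mk]
  obtain ⟨k, hk⟩ := IsArtinian.range_smul_pow_stabilizes M' (algebraMap R R' x)
  refine ⟨k, fun m => ?_⟩
  obtain ⟨n, hn⟩ : algebraMap R R' x ^ k • (LocalizedModule.mk m 1 : M') ∈
      LinearMap.range (algebraMap R R' x ^ (k + 1) • LinearMap.id : M' →ₗ[R'] M') :=
    hk (k + 1) k.le_succ ▸ ⟨_, rfl⟩
  replace hn : algebraMap R R' x ^ (k + 1) • n =
    algebraMap R R' x ^ k • (LocalizedModule.mk m 1 : M') := hn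
  induction n using LocalizedModule.induction_on with
  | _ m' t
  rw [← map_pow, ← map_pow, halg, halg, LocalizedModule.mk_eq] at hn
  obtain ⟨u, hu⟩ := hn
  refine ⟨(u * t : p.primeCompl), (u * t).2, (u : R) • m', ?_⟩
  simp only [Submonoid.smul_def, one_smul] at hu
  rw [smul_sub, sub_eq_zero, Submonoid.coe_mul, ← mul_smul, ← mul_smul, ← mul_smul] at *
  convert hu.symm using 2 <;> ring

namespace ExtFinite

variable {R : Type u} [CommRing R] [IsNoetherianRing R] {𝔞 : Ideal R}

lemma exists_uniform_exponent {X : Type u} [AddCommGroup X] [Module R X] (ht : 𝔞.IsPowTorsion X)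
    (hs : ∀ p ∈ Module.support R X, ∀ q ∈ Module.support R X, p < q → q.asIdeal.IsMaximal)
    (h : ExtFinite 𝔞 X 0) (x : R) :
    ∃ k : ℕ, ∀ p ∈ Module.support R X, ¬ p.asIdeal.IsMaximal →
      ∀ m : X, ∃ s ∉ p.asIdeal, ∃ m' : X, x ^ k • (s • m - x • m') = 0 := by
  classical
  set L := Submodule.torsionBySet R X (𝔞 : Set R)
  have hL : L.FG := h.torsionBySet_fg
  have : Module.Finite R L := Module.Finite.iff_fg.2 hL
  have hmin (p) (hp : p ∈ Module.support R X) (hpm : ¬ p.asIdeal.IsMaximal) (q : Ideal R)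
      (hq : q.IsPrime) (hle : Module.annihilator R L ≤ q) (hqp : q ≤ p.asIdeal) :
      q = p.asIdeal := by
    have hqX : (⟨q, hq⟩ : PrimeSpectrum R) ∈ Module.support R X :=
      Module.support_subset_of_injective _ L.injective_subtype
        (Module.mem_support_iff_of_finite.2 hle)
    by_contra hne
    exact hpm (hs _ hqX p hp (lt_of_le_of_ne hqp fun h => hne (congrArg PrimeSpectrum.asIdeal h)))
  have hk (p : PrimeSpectrum R) : ∃ k : ℕ, p ∈ Module.support R X → ¬ p.asIdeal.IsMaximal →
      ∀ m : X, ∃ s ∉ p.asIdeal, ∃ m' : X, x ^ k • (s • m - x • m') = 0 := by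
    by_cases hp : p ∈ Module.support R X ∧ ¬ p.asIdeal.IsMaximal
    · have := isArtinian_localizedModule ht hL p.asIdeal (hmin p hp.1 hp.2)
      obtain ⟨k, hk⟩ := exists_smul_sub_mem_ker_of_isArtinian (M := X) p.asIdeal x
      exact ⟨k, fun _ _ => hk⟩
    · exact ⟨0, fun h1 h2 => absurd ⟨h1, h2⟩ hp⟩
  choose k hk using hk
  have hfin : {p : PrimeSpectrum R | p ∈ Module.support R X ∧ ¬ p.asIdeal.IsMaximal}.Finite := by
    refine Set.Finite.of_finite_image ((Ideal.finite_minimalPrimes_of_isNoetherianRing R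
      (Module.annihilator R L)).subset ?_) (fun p _ q _ => PrimeSpectrum.ext)
    rintro _ ⟨p, ⟨hp, hpm⟩, rfl⟩
    refine ⟨⟨p.2, Module.annihilator_le_of_mem_support (mem_support_torsionBySet ht hp)⟩,
      fun q hq hqp => (hmin p hp hpm q hq.1 hq.2 hqp).ge⟩
  refine ⟨∑ p ∈ hfin.toFinset, k p, fun p hp hpm m => ?_⟩
  obtain ⟨s, hsp, m', hm⟩ := hk p hp hpm m
  refine ⟨s, hsp, m', ?_⟩
  have hle : k p ≤ ∑ p ∈ hfin.toFinset, k p :=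
    Finset.single_le_sum (f := k) (fun _ _ => Nat.zero_le _) (by simpa using ⟨hp, hpm⟩)
  rw [← Nat.sub_add_cancel hle, pow_add, mul_smul, hm, smul_zero]

/-- The finiteness of all `Ext^i_R(R/𝔞, X)` for a torsion module `X` supported in dimension at most
one follows from that for `i = 0, 1`. -/
lemma of_support_dim_le_one {X : Type u} [AddCommGroup X] [Module R X] (ht : 𝔞.IsPowTorsion X)
    (hs : ∀ p ∈ Module.support R X, ∀ q ∈ Module.support R X, p < q → q.asIdeal.IsMaximal)
    (h0 : ExtFinite 𝔞 X 0) (h1 : ExtFinite 𝔞 X 1) (i : ℕ) : ExtFinite 𝔞 X i := by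
  refine of_devissage (fun X _ _ => 𝔞.IsPowTorsion X ∧
    (∀ p ∈ Module.support R X, ∀ q ∈ Module.support R X, p < q → q.asIdeal.IsMaximal) ∧
    ExtFinite 𝔞 X 0 ∧ ExtFinite 𝔞 X 1) (fun X _ _ h => h.2.2.1) ?_ X ⟨ht, hs, h0, h1⟩ i
  clear! X
  rintro X _ _ ⟨ht, hs, h0, h1⟩ x -
  obtain ⟨k, hk⟩ := exists_uniform_exponent ht hs h0 x
  have hY0 := zero_of_injective (quotKerLsmul_injective (X := X) (x ^ k)) h0
  refine ⟨k, ?_⟩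
  set K := LinearMap.ker (LinearMap.lsmul R X (x ^ k))
  have hsK := Module.support_subset_of_injective _ K.injective_subtype
  have hsY := Module.support_subset_of_surjective _ K.mkQ_surjective
  have htY := ht.of_surjective K.mkQ_surjective
  refine ⟨⟨ht.of_injective K.injective_subtype, fun p hp q hq => hs p (hsK hp) q (hsK hq),
    zero_of_injective K.injective_subtype h0,
    left K.injective_subtype K.exact_subtype_mkQ K.mkQ_surjective hY0 h1⟩, fun hK => ?_⟩
  have hY1 := right K.injective_subtype K.exact_subtype_mkQ K.mkQ_surjective h1 (hK 2)
  set J := LinearMap.ker (LinearMap.lsmul R (X ⧸ K) x)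
  have hsJ := (Module.support_subset_of_injective _ J.injective_subtype).trans hsY
  have hJ0 := zero_of_injective (quotKerLsmul_injective (X := X ⧸ K) x) hY0
  refine ⟨⟨htY.of_injective J.injective_subtype, fun p hp q hq => hs p (hsJ hp) q (hsJ hq),
    zero_of_injective J.injective_subtype hY0,
    left J.injective_subtype J.exact_subtype_mkQ J.mkQ_surjective hJ0 hY1⟩, fun hJ => ?_⟩
  set B := LinearMap.range (LinearMap.lsmul R (X ⧸ K) x)
  have hB1 : ExtFinite 𝔞 B 1 :=
    (right J.injective_subtype J.exact_subtype_mkQ J.mkQ_surjective hY1 (hJ 2)).congr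
      (LinearMap.quotKerEquivRange _)
  refine of_support_isMaximal (htY.of_surjective B.mkQ_surjective) (fun p hp => ?_)
    (right B.injective_subtype B.exact_subtype_mkQ B.mkQ_surjective hY0 hB1)
  by_contra hpm
  have hpX := hsY (Module.support_subset_of_surjective _ B.mkQ_surjective hp)
  refine Module.notMem_support_iff'.2 (fun y => ?_) hp
  obtain ⟨y, rfl⟩ := B.mkQ_surjective y
  obtain ⟨m, rfl⟩ := K.mkQ_surjective y
  obtain ⟨s, hsp, m', hm⟩ := hk p hpX hpm m
  refine ⟨s, hsp, ?_⟩
  rw [← map_smul, ← LinearMap.mem_ker, Submodule.ker_mkQ]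
  refine ⟨K.mkQ m', ?_⟩
  rw [LinearMap.lsmul_apply, ← map_smul, ← map_smul, ← sub_eq_zero, ← map_sub, ← LinearMap.mem_ker,
    Submodule.ker_mkQ]
  change x ^ k • (x • m' - s • m) = 0
  rw [← neg_sub, smul_neg, hm, neg_zero]

/-- Variant of `ExtFinite.of_support_dim_le_one` modulo a finitely generated submodule. -/
lemma of_support_quotient_dim_le_one {X : Type u} [AddCommGroup X] [Module R X]
    (ht : 𝔞.IsPowTorsion X) {N : Submodule R X} (hN : N.FG)
    (hs : Order.krullDim (Module.support R (X ⧸ N)) < 2)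
    (h0 : ExtFinite 𝔞 X 0) (h1 : ExtFinite 𝔞 X 1) (i : ℕ) : ExtFinite 𝔞 X i := by
  have : Module.Finite R N := Module.Finite.iff_fg.2 hN
  have hr {i} (h : ExtFinite 𝔞 X i) : ExtFinite 𝔞 (X ⧸ N) i :=
    right N.injective_subtype N.exact_subtype_mkQ N.mkQ_surjective h (of_finite _)
  refine middle N.injective_subtype N.exact_subtype_mkQ N.mkQ_surjective (of_finite i)
    (of_support_dim_le_one (ht.of_surjective N.mkQ_surjective) ?_ (hr h0) (hr h1) i)
  intro p hp q hq hpq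
  by_contra hqm
  obtain ⟨m, hm, hqm'⟩ := Ideal.exists_le_maximal q.asIdeal q.2.ne_top
  have hqm'' : q < ⟨m, hm.isPrime⟩ := lt_of_le_of_ne hqm' fun h => hqm (h ▸ hm)
  have hmS := Module.mem_support_mono hqm''.le hq
  let c : LTSeries (Module.support R (X ⧸ N)) :=
    { length := 2
      toFun := ![⟨p, hp⟩, ⟨q, hq⟩, ⟨_, hmS⟩]
      step := fun i => by
        fin_cases i
        · exact hpq
        · exact hqm'' }
  exact hs.not_ge (Order.LTSeries.length_le_krullDim c)

end ExtFinite

namespace Module.DirectLimit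

variable {R : Type*} [CommRing R] {F : ℕ → Type*} [∀ n, AddCommGroup (F n)] [∀ n, Module R (F n)]
  {f : ∀ n m, n ≤ m → F n →ₗ[R] F m}

/-- A module which is the union of the images of the modules of a directed system, in such a way
that elements with trivial image eventually vanish, is the direct limit of the system. -/
noncomputable def equivOfCocone {H : Type*} [AddCommGroup H] [Module R H] (g : ∀ n, F n →ₗ[R] H)
    (hg : ∀ n m h x, g m (f n m h x) = g n x) (hinj : ∀ n x, g n x = 0 → ∃ m h, f n m h x = 0)
    (hsurj : ∀ y, ∃ n x, g n x = y) : DirectLimit F f ≃ₗ[R] H :=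
  LinearEquiv.ofBijective (lift R ℕ F f g hg) <| by
    constructor
    · rw [injective_iff_map_eq_zero]
      intro z hz
      induction z using DirectLimit.induction_on with | _ n x
      rw [lift_of] at hz
      obtain ⟨m, h, hm⟩ := hinj n x hz
      rw [← of_f (hij := h), hm, map_zero]
    · intro y
      obtain ⟨n, x, rfl⟩ := hsurj y
      exact ⟨of R ℕ F f n x, lift_of _ _ _⟩

/-- A morphism of directed systems with eventually vanishing kernel and cokernel induces an
isomorphism between the direct limits. -/
noncomputable def equivOfIndEquiv {F' : ℕ → Type*} [∀ n, AddCommGroup (F' n)]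
    [∀ n, Module R (F' n)] {f' : ∀ n m, n ≤ m → F' n →ₗ[R] F' m}
    [DirectedSystem F (f · · ·)] [DirectedSystem F' (f' · · ·)] (g : ∀ n, F n →ₗ[R] F' n)
    (hg : ∀ n m h x, g m (f n m h x) = f' n m h (g n x))
    (hinj : ∀ n x, g n x = 0 → ∃ m h, f n m h x = 0)
    (hsurj : ∀ n y, ∃ m h x, g m x = f' n m h y) : DirectLimit F f ≃ₗ[R] DirectLimit F' f' :=
  equivOfCocone (fun n => of R ℕ F' f' n ∘ₗ g n)
    (fun n m h x => by rw [LinearMap.comp_apply, hg, of_f, LinearMap.comp_apply])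
    (fun n x hx => by
      obtain ⟨m, h, hm⟩ := of.zero_exact hx
      rw [← hg] at hm
      obtain ⟨k, h', hk⟩ := hinj m _ hm
      refine ⟨k, h.trans h', ?_⟩
      rwa [DirectedSystem.map_map (f := (f · · ·))] at hk)
    (fun y => by
      induction y using DirectLimit.induction_on with | _ n y
      obtain ⟨m, h, x, hx⟩ := hsurj n y
      exact ⟨m, x, by rw [LinearMap.comp_apply, hx, of_f]⟩)

end Module.DirectLimit

namespace LocalExt

variable {R : Type u} [CommRing R] (𝔞 : Ideal R)

/-- The projection `R/𝔞^m → R/𝔞^n` for `n ≤ m`. -/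
def proj {n m : ℕ} (h : n ≤ m) : ModuleCat.of R (R ⧸ 𝔞 ^ m) ⟶ ModuleCat.of R (R ⧸ 𝔞 ^ n) :=
  ModuleCat.ofHom (Submodule.mapQ _ _ LinearMap.id (Ideal.pow_le_pow_right h))

lemma proj_refl (n : ℕ) : proj 𝔞 (le_refl n) = 𝟙 _ := by
  ext
  rfl

lemma proj_comp {n m k : ℕ} (h : n ≤ m) (h' : m ≤ k) :
    proj 𝔞 h' ≫ proj 𝔞 h = proj 𝔞 (h.trans h') := by
  ext
  rfl

variable (X Y : Type u) [AddCommGroup X] [Module R X] [AddCommGroup Y] [Module R Y]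

/-- The restriction maps `Ext^i_R(R/𝔞^n, X) → Ext^i_R(R/𝔞^m, X)`. -/
noncomputable def res (i : ℕ) (n m : ℕ) (h : n ≤ m) :
    Abelian.Ext (ModuleCat.of R (R ⧸ 𝔞 ^ n)) (ModuleCat.of R X) i →ₗ[R]
      Abelian.Ext (ModuleCat.of R (R ⧸ 𝔞 ^ m)) (ModuleCat.of R X) i :=
  (Abelian.Ext.mk₀ (proj 𝔞 h)).precompOfLinear R _ (zero_add i)

lemma res_apply (i : ℕ) {n m : ℕ} (h : n ≤ m)
    (c : Abelian.Ext (ModuleCat.of R (R ⧸ 𝔞 ^ n)) (ModuleCat.of R X) i) :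
    res 𝔞 X i n m h c = (Abelian.Ext.mk₀ (proj 𝔞 h)).comp c (zero_add i) := rfl

lemma res_res (i : ℕ) {n m k : ℕ} (h : n ≤ m) (h' : m ≤ k)
    (c : Abelian.Ext (ModuleCat.of R (R ⧸ 𝔞 ^ n)) (ModuleCat.of R X) i) :
    res 𝔞 X i m k h' (res 𝔞 X i n m h c) = res 𝔞 X i n k (h.trans h') c := by
  rw [res_apply, res_apply, res_apply, ← proj_comp 𝔞 h h', ← Abelian.Ext.mk₀_comp_mk₀_assoc]

instance directedSystem (i : ℕ) : DirectedSystem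
    (fun n => Abelian.Ext (ModuleCat.of R (R ⧸ 𝔞 ^ n)) (ModuleCat.of R X) i)
    (res 𝔞 X i · · ·) where
  map_self n c := by rw [res_apply, proj_refl, Abelian.Ext.mk₀_id_comp]
  map_map _ _ _ h h' c := res_res 𝔞 X i h h' c

variable {X Y} in
lemma res_map (f : X →ₗ[R] Y) (i : ℕ) {n m : ℕ} (h : n ≤ m)
    (c : Abelian.Ext (ModuleCat.of R (R ⧸ 𝔞 ^ n)) (ModuleCat.of R X) i) :
    ModuleExt.map _ f i (res 𝔞 X i n m h c) = res 𝔞 Y i n m h (ModuleExt.map _ f i c) := by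
  rw [res_apply, res_apply, ModuleExt.map_apply, ModuleExt.map_apply,
    Abelian.Ext.comp_assoc_of_third_deg_zero]

variable {X Y} in
lemma res_δ {K : Type u} [AddCommGroup K] [Module R K] {f : K →ₗ[R] X} {g : X →ₗ[R] Y}
    (hf : Function.Injective f) (hfg : Function.Exact f g) (hg : Function.Surjective g)
    (i : ℕ) {n m : ℕ} (h : n ≤ m)
    (c : Abelian.Ext (ModuleCat.of R (R ⧸ 𝔞 ^ n)) (ModuleCat.of R Y) i) :
    ModuleExt.δ _ hf hfg hg i (res 𝔞 Y i n m h c) =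
      res 𝔞 K (i + 1) n m h (ModuleExt.δ _ hf hfg hg i c) := by
  rw [res_apply, res_apply, ModuleExt.δ_apply, ModuleExt.δ_apply]
  exact Abelian.Ext.comp_assoc _ _ _ _ _ (by omega)

/-- The direct limit of the modules `Ext^i_R(R/𝔞^n, X)`. -/
abbrev limit (i : ℕ) : Type u :=
  Module.DirectLimit (fun n => Abelian.Ext (ModuleCat.of R (R ⧸ 𝔞 ^ n)) (ModuleCat.of R X) i)
    (res 𝔞 X i)

/-- The canonical map from `Ext^i_R(R/𝔞^n, X)` to the direct limit. -/
noncomputable abbrev toLimit (i n : ℕ) :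
    Abelian.Ext (ModuleCat.of R (R ⧸ 𝔞 ^ n)) (ModuleCat.of R X) i →ₗ[R] limit 𝔞 X i :=
  Module.DirectLimit.of R ℕ
    (fun n => Abelian.Ext (ModuleCat.of R (R ⧸ 𝔞 ^ n)) (ModuleCat.of R X) i) (res 𝔞 X i) n

open Limits in
/-- Local cohomology as a direct limit of `Ext` modules. -/
noncomputable def limitEquivLocalCohomology (i : ℕ) :
    limit 𝔞 X i ≃ₗ[R] (localCohomology 𝔞 i).obj (ModuleCat.of R X) :=
  let D := localCohomology.diagram (localCohomology.idealPowersDiagram 𝔞) i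
  let ev := (evaluation (ModuleCat.{u} R) (ModuleCat.{u} R)).obj (ModuleCat.of R X)
  let c : Cocone (D ⋙ ev) := ev.mapCocone (colimit.cocone D)
  have hc : IsColimit c := isColimitOfPreserves ev (colimit.isColimit D)
  let e (n : ℕ) : (D ⋙ ev).obj (Opposite.op (Opposite.op n)) ≅ _ :=
    ExtComparison.extIso (ModuleCat.of R (R ⧸ 𝔞 ^ n)) (ModuleCat.of R X) i
  have hD {n m : ℕ} (h : n ≤ m) : (D ⋙ ev).map (homOfLE h).op.op ≫ (e m).hom =
      (e n).hom ≫ ModuleCat.ofHom (res 𝔞 X i n m h) :=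
    ExtComparison.extIso_naturality (proj 𝔞 h) (ModuleCat.of R X) i
  let t : Cocone (D ⋙ ev) :=
    { pt := ModuleCat.of R (limit 𝔞 X i)
      ι :=
        { app n := (e n.unop.unop).hom ≫ ModuleCat.ofHom (toLimit 𝔞 X i n.unop.unop)
          naturality n m h := by
            have h' : n.unop.unop ≤ m.unop.unop := leOfHom h.unop.unop
            refine Eq.trans ?_ (Category.comp_id _).symm
            refine (Category.assoc _ _ _).symm.trans ?_
            refine (congrArg (· ≫ _) (hD h')).trans ?_
            rw [Category.assoc]
            congr 1
            ext x
            exact Module.DirectLimit.of_f } }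
  let p (n : ℕ) : Abelian.Ext (ModuleCat.of R (R ⧸ 𝔞 ^ n)) (ModuleCat.of R X) i →ₗ[R] c.pt :=
    ((e n).inv ≫ c.ι.app (Opposite.op (Opposite.op n))).hom
  have hp (n m : ℕ) (h : n ≤ m) (x) : p m (res 𝔞 X i n m h x) = p n x := by
    have h1 : ModuleCat.ofHom (res 𝔞 X i n m h) ≫ (e m).inv =
        (e n).inv ≫ (D ⋙ ev).map (homOfLE h).op.op := by
      rw [Iso.comp_inv_eq, Category.assoc, hD, Iso.inv_hom_id_assoc]
    have h2 : ModuleCat.ofHom (res 𝔞 X i n m h) ≫ (e m).inv ≫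
        c.ι.app (Opposite.op (Opposite.op m)) =
          (e n).inv ≫ c.ι.app (Opposite.op (Opposite.op n)) := by
      rw [← Category.assoc, h1, Category.assoc, c.w]
    exact congrArg (fun k => k.hom x) h2
  let q : limit 𝔞 X i →ₗ[R] c.pt := Module.DirectLimit.lift R ℕ _ _ p hp
  LinearEquiv.ofLinearMap q (hc.desc t).hom
    (by
      have : hc.desc t ≫ ModuleCat.ofHom q = 𝟙 c.pt := by
        refine hc.hom_ext fun n => ?_
        rw [hc.fac_assoc, Category.comp_id]
        change ((e n.unop.unop).hom ≫ _) ≫ _ = _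
        rw [Category.assoc, ← Iso.eq_inv_comp]
        ext x
        exact Module.DirectLimit.lift_of p hp _
      exact congrArg ModuleCat.Hom.hom this)
    (by
      refine Module.DirectLimit.hom_ext fun n => ?_
      ext x
      have h : ((e n).inv ≫ c.ι.app (Opposite.op (Opposite.op n))) ≫ hc.desc t =
          ModuleCat.ofHom (toLimit 𝔞 X i n) := by
        rw [Category.assoc, hc.fac]
        exact (e n).inv_hom_id_assoc _
      have h2 := congrArg (fun k => k.hom x) h
      refine Eq.trans ?_ h2
      exact congrArg (hc.desc t).hom (Module.DirectLimit.lift_of p hp _))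

end LocalExt

section PowTorsion

variable {R : Type*} [CommRing R] (𝔞 : Ideal R) (M : Type*) [AddCommGroup M] [Module R M]

/-- The submodule of the elements killed by a power of an ideal. -/
def Ideal.powTorsion : Submodule R M where
  carrier := {m | ∃ n, ∀ x ∈ 𝔞 ^ n, x • m = 0}
  add_mem' := by
    rintro a b ⟨n, hn⟩ ⟨k, hk⟩
    refine ⟨n + k, fun x hx => ?_⟩
    rw [smul_add, hn x (Ideal.pow_le_pow_right (Nat.le_add_right n k) hx),
      hk x (Ideal.pow_le_pow_right (Nat.le_add_left k n) hx), add_zero]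
  zero_mem' := ⟨0, fun x _ => smul_zero x⟩
  smul_mem' := by
    rintro r m ⟨n, hn⟩
    exact ⟨n, fun x hx => by rw [smul_comm, hn x hx, smul_zero]⟩

namespace Ideal

variable {𝔞 M}

variable {N : Type*} [AddCommGroup N] [Module R N]

lemma map_mem_powTorsion (f : M →ₗ[R] N) {m : M} (h : m ∈ 𝔞.powTorsion M) :
    f m ∈ 𝔞.powTorsion N := by
  obtain ⟨n, hn⟩ := h
  exact ⟨n, fun x hx => by rw [← map_smul, hn x hx, map_zero]⟩

lemma mem_powTorsion_of_map_mem {f : M →ₗ[R] N} (hf : Function.Injective f) {m : M}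
    (h : f m ∈ 𝔞.powTorsion N) : m ∈ 𝔞.powTorsion M := by
  obtain ⟨n, hn⟩ := h
  exact ⟨n, fun x hx => hf (by rw [map_smul, hn x hx, map_zero])⟩

lemma powTorsion_eq_top_of_surjective {f : M →ₗ[R] N} (hf : Function.Surjective f)
    (h : 𝔞.powTorsion M = ⊤) : 𝔞.powTorsion N = ⊤ := by
  refine Submodule.eq_top_iff'.2 fun y => ?_
  obtain ⟨m, rfl⟩ := hf y
  exact map_mem_powTorsion f (Submodule.eq_top_iff'.1 h m)

lemma powTorsion_powTorsion : 𝔞.powTorsion (𝔞.powTorsion M) = ⊤ :=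
  Submodule.eq_top_iff'.2 fun m =>
    mem_powTorsion_of_map_mem (𝔞.powTorsion M).injective_subtype m.2

lemma IsPowTorsion.of_powTorsion_eq_top (h : 𝔞.powTorsion M = ⊤) : 𝔞.IsPowTorsion M :=
  fun x hx m => by
    obtain ⟨n, hn⟩ := Submodule.eq_top_iff'.1 h m
    exact ⟨n, hn _ (Ideal.pow_mem_pow hx n)⟩

lemma IsPowTorsion.support_subset (h : 𝔞.IsPowTorsion M) :
    Module.support R M ⊆ PrimeSpectrum.zeroLocus (𝔞 : Set R) := by
  intro p hp x hx
  obtain ⟨m, hm⟩ := Module.mem_support_iff_exists_annihilator.1 hp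
  obtain ⟨n, hn⟩ := h x hx m
  refine p.2.mem_of_pow_mem n (hm ?_)
  rwa [Submodule.mem_annihilator_span_singleton]

lemma exists_pow_of_fg {P : Submodule R M} (hP : P.FG) (h : P ≤ 𝔞.powTorsion M) :
    ∃ n, ∀ x ∈ 𝔞 ^ n, ∀ m ∈ P, x • m = 0 := by
  obtain ⟨S, rfl⟩ := hP
  have h' : ∀ m ∈ S, ∃ n, ∀ x ∈ 𝔞 ^ n, x • m = 0 := fun m hm => h (Submodule.subset_span hm)
  choose! k hk using h'
  refine ⟨S.sup k, fun x hx => ?_⟩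
  have hle : Submodule.span R (S : Set M) ≤ LinearMap.ker (LinearMap.lsmul R M x) :=
    Submodule.span_le.2 fun s hs => hk s hs x (Ideal.pow_le_pow_right (Finset.le_sup hs) hx)
  exact fun m hm => hle hm

variable [IsNoetherianRing R]

lemma mem_powTorsion_of_forall_smul_mem {m : M} {n : ℕ}
    (h : ∀ x ∈ 𝔞 ^ n, x • m ∈ 𝔞.powTorsion M) : m ∈ 𝔞.powTorsion M := by
  obtain ⟨S, hS⟩ := (isNoetherianRing_iff_ideal_fg R).1 inferInstance (𝔞 ^ n)
  choose! k hk using h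
  let K := S.sup k
  refine ⟨K + n, fun x hx => ?_⟩
  rw [pow_add, ← hS] at hx
  induction hx using Submodule.mul_induction_on' with
  | mem_mul_mem a ha b hb =>
    have hle : Ideal.span (S : Set R) ≤ LinearMap.ker
        (LinearMap.lsmul R M a ∘ₗ LinearMap.toSpanSingleton R M m) := by
      refine Ideal.span_le.2 fun s hs => ?_
      have hs' : s ∈ 𝔞 ^ n := hS ▸ Ideal.subset_span hs
      exact hk s hs' a (Ideal.pow_le_pow_right (Finset.le_sup hs) ha)
    have := hle hb
    rw [mul_smul]
    exact this
  | add a _ b _ ha hb => rw [add_smul, ha, hb, add_zero]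

lemma powTorsion_quotient_powTorsion : 𝔞.powTorsion (M ⧸ 𝔞.powTorsion M) = ⊥ := by
  refine (Submodule.eq_bot_iff _).2 fun y hy => ?_
  obtain ⟨m, rfl⟩ := Submodule.mkQ_surjective _ y
  obtain ⟨n, hn⟩ := hy
  refine (Submodule.Quotient.mk_eq_zero _).2 (mem_powTorsion_of_forall_smul_mem (n := n) ?_)
  intro x hx
  exact (Submodule.Quotient.mk_eq_zero _).1 (hn x hx)

end Ideal

end PowTorsion

namespace Module.Injective

variable {R : Type u} [CommRing R] {E : Type u} [AddCommGroup E] [Module R E]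

lemma exists_comp_eq [Module.Injective R E] {X Y : Type u} [AddCommGroup X] [Module R X]
    [AddCommGroup Y] [Module R Y] (φ : X →ₗ[R] Y) (f : X →ₗ[R] E)
    (h : LinearMap.ker φ ≤ LinearMap.ker f) : ∃ g : Y →ₗ[R] E, g ∘ₗ φ = f := by
  obtain ⟨g, hg⟩ := Module.Injective.out (Q := E) (Submodule.liftQ _ φ le_rfl)
    (LinearMap.ker_eq_bot.1 (Submodule.ker_liftQ_eq_bot _ _ _ le_rfl)) (Submodule.liftQ _ f h)
  exact ⟨g, LinearMap.ext fun x => hg (Submodule.Quotient.mk x)⟩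

lemma of_comp_eq_id [Module.Injective R E] {P : Type u} [AddCommGroup P] [Module R P]
    (s : P →ₗ[R] E) (p : E →ₗ[R] P) (h : ∀ x, p (s x) = x) : Module.Injective R P where
  out X Y _ _ _ _ f hf g := by
    obtain ⟨k, hk⟩ := Module.Injective.out f hf (s ∘ₗ g)
    exact ⟨p ∘ₗ k, fun x => by rw [LinearMap.comp_apply, hk, LinearMap.comp_apply, h]⟩

lemma quotient [Module.Injective R E] (P : Submodule R E) [Module.Injective R P] :
    Module.Injective R (E ⧸ P) := by
  obtain ⟨r, hr⟩ := Module.Injective.out P.subtype P.injective_subtype (LinearMap.id : P →ₗ[R] P)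
  refine of_comp_eq_id (P.liftQ (LinearMap.id - P.subtype ∘ₗ r) fun x hx => ?_) P.mkQ fun y => ?_
  · have := hr ⟨x, hx⟩
    simp only [LinearMap.mem_ker, LinearMap.sub_apply, LinearMap.id_apply, LinearMap.comp_apply]
    rw [sub_eq_zero]
    exact (congrArg P.subtype this).symm
  · obtain ⟨x, rfl⟩ := P.mkQ_surjective y
    change P.mkQ (x - P.subtype (r x)) = P.mkQ x
    rw [map_sub, sub_eq_self]
    exact (Submodule.Quotient.mk_eq_zero _).2 (r x).2

lemma powTorsion [IsNoetherianRing R] [Module.Injective R E] (𝔞 : Ideal R) :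
    Module.Injective R (𝔞.powTorsion E) := by
  refine Module.Baer.injective fun J f => ?_
  obtain ⟨n, hn⟩ := Ideal.exists_pow_of_fg (𝔞 := 𝔞) (M := 𝔞.powTorsion E)
    (P := LinearMap.range f) (by
      rw [LinearMap.range_eq_map]
      exact Module.Finite.fg_top.map f)
    (by rw [Ideal.powTorsion_powTorsion]; exact le_top)
  obtain ⟨k, hk⟩ := Ideal.exists_pow_inf_eq_pow_smul 𝔞 (M := R) J
  have hkn := hk (n + k) (Nat.le_add_left k n)
  obtain ⟨g, hg⟩ := exists_comp_eq ((𝔞 ^ (n + k)).mkQ ∘ₗ J.subtype)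
    ((𝔞.powTorsion E).subtype ∘ₗ f) (by
      rintro ⟨x, hxJ⟩ hx
      have hx' : x ∈ 𝔞 ^ (n + k) := (Submodule.Quotient.mk_eq_zero _).1 hx
      have hmem : x ∈ 𝔞 ^ n • (𝔞 ^ k • ⊤ ⊓ J : Submodule R R) := by
        rw [Nat.add_sub_cancel] at hkn
        rw [← hkn]
        exact ⟨by simpa using hx', hxJ⟩
      have hle : 𝔞 ^ n • (𝔞 ^ k • ⊤ ⊓ J : Submodule R R) ≤ (LinearMap.ker f).map J.subtype := by
        refine Submodule.smul_le.2 fun a ha b hb => ⟨a • ⟨b, hb.2⟩, ?_, rfl⟩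
        change f (a • ⟨b, hb.2⟩) = 0
        rw [map_smul]
        exact hn a ha _ ⟨_, rfl⟩
      obtain ⟨y, hy, hyx⟩ := hle hmem
      obtain rfl : y = ⟨x, hxJ⟩ := Subtype.ext hyx
      have hy' : f ⟨x, hxJ⟩ = 0 := hy
      simp [hy'])
  have hg' (x : R ⧸ 𝔞 ^ (n + k)) : g x ∈ 𝔞.powTorsion E := by
    refine Ideal.map_mem_powTorsion g ⟨n + k, fun a ha => ?_⟩
    obtain ⟨r, rfl⟩ := Submodule.mkQ_surjective _ x
    exact (Submodule.Quotient.mk_eq_zero _).2 (Ideal.mul_mem_right r _ ha)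
  refine ⟨(g.codRestrict _ hg') ∘ₗ (𝔞 ^ (n + k)).mkQ, fun x hx => Subtype.ext ?_⟩
  exact LinearMap.congr_fun hg ⟨x, hx⟩

end Module.Injective

namespace LocalExt

variable {R : Type u} [CommRing R]

section EvalOne

variable (I : Ideal R) (X : Type u) [AddCommGroup X] [Module R X]

/-- The evaluation at `1` of elements of `Ext^0_R(R/I, X) = Hom_R(R/I, X)`. -/
noncomputable def evalOne :
    Abelian.Ext (ModuleCat.of R (R ⧸ I)) (ModuleCat.of R X) 0 →ₗ[R] X :=
  LinearMap.applyₗ (1 : R ⧸ I) ∘ₗ ((Abelian.Ext.linearEquiv₀ (R := R)).trans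
    (ModuleCat.homLinearEquiv (M := ModuleCat.of R (R ⧸ I)) (N := ModuleCat.of R X)
      (S := R))).toLinearMap

variable {I X}

lemma evalOne_mk₀ (φ : ModuleCat.of R (R ⧸ I) ⟶ ModuleCat.of R X) :
    evalOne I X (Abelian.Ext.mk₀ φ) = φ.hom (1 : R ⧸ I) := by
  have h : Abelian.Ext.linearEquiv₀ (R := R) (Abelian.Ext.mk₀ φ) = φ :=
    (Abelian.Ext.linearEquiv₀ (R := R)).apply_symm_apply φ
  change (Abelian.Ext.linearEquiv₀ (R := R) (Abelian.Ext.mk₀ φ)).hom (1 : R ⧸ I) = _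
  rw [h]

lemma exists_mk₀_eq (c : Abelian.Ext (ModuleCat.of R (R ⧸ I)) (ModuleCat.of R X) 0) :
    ∃ φ, Abelian.Ext.mk₀ φ = c :=
  ⟨_, Abelian.Ext.mk₀_linearEquiv₀_apply (R := R) c⟩

lemma smul_evalOne {x : R} (hx : x ∈ I)
    (c : Abelian.Ext (ModuleCat.of R (R ⧸ I)) (ModuleCat.of R X) 0) : x • evalOne I X c = 0 := by
  rw [← map_smul, ExtFinite.smul_ext_eq_zero hx, map_zero]

lemma evalOne_injective : Function.Injective (evalOne I X) := by
  rw [injective_iff_map_eq_zero]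
  intro c hc
  obtain ⟨φ, rfl⟩ := exists_mk₀_eq c
  rw [evalOne_mk₀] at hc
  have : φ = 0 := by
    ext
    exact hc
  rw [this, Abelian.Ext.mk₀_zero]

lemma exists_evalOne_eq {m : X} (h : ∀ x ∈ I, x • m = 0) : ∃ c, evalOne I X c = m := by
  refine ⟨Abelian.Ext.mk₀ (ModuleCat.ofHom
    (Submodule.liftQ I (LinearMap.toSpanSingleton R X m) h)), ?_⟩
  rw [evalOne_mk₀]
  exact one_smul R m

lemma evalOne_map {Y : Type u} [AddCommGroup Y] [Module R Y] (f : X →ₗ[R] Y)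
    (c : Abelian.Ext (ModuleCat.of R (R ⧸ I)) (ModuleCat.of R X) 0) :
    evalOne I Y (ModuleExt.map _ f 0 c) = f (evalOne I X c) := by
  obtain ⟨φ, rfl⟩ := exists_mk₀_eq c
  rw [ModuleExt.map_apply, Abelian.Ext.mk₀_comp_mk₀, evalOne_mk₀, evalOne_mk₀]
  rfl

end EvalOne

variable {𝔞 : Ideal R} {X : Type u} [AddCommGroup X] [Module R X]

lemma evalOne_res {n m : ℕ} (h : n ≤ m)
    (c : Abelian.Ext (ModuleCat.of R (R ⧸ 𝔞 ^ n)) (ModuleCat.of R X) 0) :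
    evalOne (𝔞 ^ m) X (res 𝔞 X 0 n m h c) = evalOne (𝔞 ^ n) X c := by
  obtain ⟨φ, rfl⟩ := exists_mk₀_eq c
  rw [res_apply, Abelian.Ext.mk₀_comp_mk₀, evalOne_mk₀, evalOne_mk₀]
  rfl

variable (𝔞 X) in
lemma powTorsion_limit (i : ℕ) : 𝔞.powTorsion (limit 𝔞 X i) = ⊤ := by
  refine Submodule.eq_top_iff'.2 fun y => ?_
  induction y using Module.DirectLimit.induction_on with | _ n c
  exact ⟨n, fun x hx => by rw [← map_smul, ExtFinite.smul_ext_eq_zero hx, map_zero]⟩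

variable (𝔞 X) in
/-- The zeroth local cohomology module is the submodule of torsion elements. -/
noncomputable def limitZeroEquiv : limit 𝔞 X 0 ≃ₗ[R] 𝔞.powTorsion X :=
  Module.DirectLimit.equivOfCocone
    (fun n => (evalOne (𝔞 ^ n) X).codRestrict _ fun c => ⟨n, fun _ hx => smul_evalOne hx c⟩)
    (fun n m h c => Subtype.ext (evalOne_res h c))
    (fun n c hc => ⟨n, le_rfl, by
      rw [(injective_iff_map_eq_zero _).1 evalOne_injective c (congrArg Subtype.val hc), map_zero]⟩)
    (fun ⟨m, n, hn⟩ => by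
      obtain ⟨c, hc⟩ := exists_evalOne_eq hn
      exact ⟨n, c, Subtype.ext hc⟩)

lemma subsingleton_ext_zero (h : 𝔞.powTorsion X = ⊥) {I : Ideal R} {n : ℕ} (hI : 𝔞 ^ n ≤ I) :
    Subsingleton (Abelian.Ext (ModuleCat.of R (R ⧸ I)) (ModuleCat.of R X) 0) := by
  refine ⟨fun c d => evalOne_injective ?_⟩
  have hz (c) : evalOne I X c = 0 :=
    (Submodule.eq_bot_iff _).1 h _ ⟨n, fun x hx => smul_evalOne (hI hx) c⟩
  rw [hz, hz]

lemma subsingleton_ext_succ_of_injective [Module.Injective R X] (N : ModuleCat.{u} R) (i : ℕ) :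
    Subsingleton (Abelian.Ext N (ModuleCat.of R X) (i + 1)) := by
  have : Injective (ModuleCat.of R X) := Module.injective_object_of_injective_module R X
  exact Abelian.Ext.subsingleton_of_injective _ _ _

lemma exists_injective_embedding (X : Type u) [AddCommGroup X] [Module R X] :
    ∃ (E : Type u) (_ : AddCommGroup E) (_ : Module R E) (f : X →ₗ[R] E),
      Module.Injective R E ∧ Function.Injective f := by
  let E := Injective.under (ModuleCat.of R X)
  refine ⟨E, inferInstance, inferInstance, (Injective.ι (ModuleCat.of R X)).hom, ?_, ?_⟩
  · have : Injective (ModuleCat.of R E) :=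
      inferInstanceAs (Injective (Injective.under (ModuleCat.of R X)))
    exact Module.injective_module_of_injective_object R E
  · exact (ModuleCat.mono_iff_injective _).1 inferInstance

variable [IsNoetherianRing R]

lemma exists_powTorsion_injective_embedding (h : 𝔞.powTorsion X = ⊤) :
    ∃ (E : Type u) (_ : AddCommGroup E) (_ : Module R E) (f : X →ₗ[R] E),
      Module.Injective R E ∧ Function.Injective f ∧ 𝔞.powTorsion E = ⊤ := by
  obtain ⟨E, _, _, f, _, hf⟩ := exists_injective_embedding (R := R) X
  refine ⟨𝔞.powTorsion E, inferInstance, inferInstance, f.codRestrict _ fun x =>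
    Ideal.map_mem_powTorsion f (Submodule.eq_top_iff'.1 h x), Module.Injective.powTorsion 𝔞,
    fun x y hxy => hf (congrArg Subtype.val hxy), Ideal.powTorsion_powTorsion⟩

lemma exists_injective_embedding_of_powTorsion_eq_bot (h : 𝔞.powTorsion X = ⊥) :
    ∃ (E : Type u) (_ : AddCommGroup E) (_ : Module R E) (f : X →ₗ[R] E),
      Module.Injective R E ∧ Function.Injective f ∧ 𝔞.powTorsion E = ⊥ := by
  obtain ⟨E, _, _, f, _, hf⟩ := exists_injective_embedding (R := R) X
  have : Module.Injective R (𝔞.powTorsion E) := Module.Injective.powTorsion 𝔞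
  refine ⟨E ⧸ 𝔞.powTorsion E, inferInstance, inferInstance, (𝔞.powTorsion E).mkQ ∘ₗ f,
    Module.Injective.quotient _, ?_, Ideal.powTorsion_quotient_powTorsion⟩
  rw [injective_iff_map_eq_zero]
  intro x hx
  have hx' : f x ∈ 𝔞.powTorsion E := (Submodule.Quotient.mk_eq_zero _).1 hx
  exact (Submodule.eq_bot_iff _).1 h x (Ideal.mem_powTorsion_of_map_mem hf hx')

/-- Positive degree `Ext` classes with values in a torsion module become trivial after
restriction. -/
lemma exists_res_eq_zero (i : ℕ) (h : 𝔞.powTorsion X = ⊤) (n : ℕ)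
    (c : Abelian.Ext (ModuleCat.of R (R ⧸ 𝔞 ^ n)) (ModuleCat.of R X) (i + 1)) :
    ∃ m, ∃ hm : n ≤ m, res 𝔞 X (i + 1) n m hm c = 0 := by
  induction i generalizing X with
  | zero =>
    obtain ⟨E, _, _, f, _, hf, hE⟩ := exists_powTorsion_injective_embedding h
    have hfg : Function.Exact f (LinearMap.range f).mkQ := LinearMap.exact_map_mkQ_range f
    have hg := (LinearMap.range f).mkQ_surjective
    have := subsingleton_ext_succ_of_injective (X := E) (ModuleCat.of R (R ⧸ 𝔞 ^ n)) 0
    obtain ⟨d, rfl⟩ := (ModuleExt.exact_δ_map _ hf hfg hg 0 c).1 (Subsingleton.elim _ _)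
    obtain ⟨y, hy⟩ := hg (evalOne _ _ d)
    obtain ⟨k, hk⟩ := Submodule.eq_top_iff'.1 hE y
    obtain ⟨b, hb⟩ := exists_evalOne_eq (I := 𝔞 ^ (n + k)) (m := y) fun x hx =>
      hk x (Ideal.pow_le_pow_right (Nat.le_add_left k n) hx)
    refine ⟨n + k, Nat.le_add_right n k, ?_⟩
    rw [← res_δ]
    refine (ModuleExt.exact_map_δ _ hf hfg hg 0 _).2 ⟨b, evalOne_injective ?_⟩
    rw [evalOne_map, evalOne_res, hb, hy]
  | succ i ih =>
    obtain ⟨E, _, _, f, _, hf, hE⟩ := exists_powTorsion_injective_embedding h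
    have hfg : Function.Exact f (LinearMap.range f).mkQ := LinearMap.exact_map_mkQ_range f
    have hg := (LinearMap.range f).mkQ_surjective
    have := subsingleton_ext_succ_of_injective (X := E) (ModuleCat.of R (R ⧸ 𝔞 ^ n)) (i + 1)
    obtain ⟨d, rfl⟩ := (ModuleExt.exact_δ_map _ hf hfg hg (i + 1) c).1 (Subsingleton.elim _ _)
    obtain ⟨m, hm, hd⟩ := ih (Ideal.powTorsion_eq_top_of_surjective hg hE) d
    exact ⟨m, hm, by rw [← res_δ, hd, map_zero]⟩

/-- Local cohomology in positive degrees does not change when killing the torsion submodule. -/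
noncomputable def limitQuotientEquiv {K Y : Type u} [AddCommGroup K] [Module R K] [AddCommGroup Y]
    [Module R Y] {f : K →ₗ[R] X} {g : X →ₗ[R] Y} (hf : Function.Injective f)
    (hfg : Function.Exact f g) (hg : Function.Surjective g) (h : 𝔞.powTorsion K = ⊤) (i : ℕ) :
    limit 𝔞 X (i + 1) ≃ₗ[R] limit 𝔞 Y (i + 1) :=
  Module.DirectLimit.equivOfIndEquiv (fun n => ModuleExt.map _ g (i + 1))
    (fun n m hm c => res_map 𝔞 g (i + 1) hm c)
    (fun n c hc => by
      obtain ⟨b, rfl⟩ := (ModuleExt.exact_map_map _ hf hfg hg (i + 1) c).1 hc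
      obtain ⟨m, hm, hb⟩ := exists_res_eq_zero i h n b
      exact ⟨m, hm, by rw [← res_map, hb, map_zero]⟩)
    (fun n c => by
      obtain ⟨m, hm, hb⟩ := exists_res_eq_zero (i + 1) h n (ModuleExt.δ _ hf hfg hg (i + 1) c)
      rw [← res_δ] at hb
      obtain ⟨b, hb⟩ := (ModuleExt.exact_map_δ _ hf hfg hg (i + 1) _).1 hb
      exact ⟨m, hm, b, hb⟩)

/-- The connecting isomorphism of `Ext` modules when the middle term has trivial `Ext` modules. -/
noncomputable def extSuccEquiv {K Y : Type u} [AddCommGroup K] [Module R K] [AddCommGroup Y]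
    [Module R Y] {f : K →ₗ[R] X} {g : X →ₗ[R] Y} (hf : Function.Injective f)
    (hfg : Function.Exact f g) (hg : Function.Surjective g) (N : ModuleCat.{u} R)
    (h : ∀ i, Subsingleton (Abelian.Ext N (ModuleCat.of R X) i)) (i : ℕ) :
    Abelian.Ext N (ModuleCat.of R Y) i ≃ₗ[R] Abelian.Ext N (ModuleCat.of R K) (i + 1) :=
  LinearEquiv.ofBijective (ModuleExt.δ N hf hfg hg i) <| by
    constructor
    · rw [injective_iff_map_eq_zero]
      intro c hc
      obtain ⟨b, rfl⟩ := (ModuleExt.exact_map_δ _ hf hfg hg i c).1 hc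
      rw [(h i).elim b 0, map_zero]
    · intro c
      exact (ModuleExt.exact_δ_map _ hf hfg hg i c).1 ((h (i + 1)).elim _ _)

/-- Local cohomology shifts along a short exact sequence whose middle term has trivial `Ext`
modules. -/
noncomputable def limitSuccEquiv {K Y : Type u} [AddCommGroup K] [Module R K] [AddCommGroup Y]
    [Module R Y] {f : K →ₗ[R] X} {g : X →ₗ[R] Y} (hf : Function.Injective f)
    (hfg : Function.Exact f g) (hg : Function.Surjective g)
    (h : ∀ n i, Subsingleton
      (Abelian.Ext (ModuleCat.of R (R ⧸ 𝔞 ^ n)) (ModuleCat.of R X) i)) (i : ℕ) :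
    limit 𝔞 Y i ≃ₗ[R] limit 𝔞 K (i + 1) :=
  Module.DirectLimit.congr (fun n => extSuccEquiv hf hfg hg _ (h n) i)
    (fun _ _ hm => LinearMap.ext fun c => res_δ 𝔞 hf hfg hg i hm c)

end LocalExt

section Transfer

variable {R : Type u} [CommRing R] {M N : Type u} [AddCommGroup M] [Module R M]
  [AddCommGroup N] [Module R N]

lemma IsFDLT.of_linearEquiv {n : ℕ} (e : M ≃ₗ[R] N) (h : IsFDLT R n M) : IsFDLT R n N := by
  obtain ⟨P, hP, hs⟩ := h
  refine ⟨P.map e.toLinearMap, hP.map _, ?_⟩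
  rwa [← (Submodule.Quotient.equiv P (P.map e.toLinearMap) e rfl).support_eq]

lemma finite_extModule_iff (𝔞 : Ideal R) (i : ℕ) :
    Module.Finite R (extModule R (R ⧸ 𝔞) M i) ↔ ExtFinite 𝔞 M i :=
  Module.Finite.equiv_iff
    (ExtComparison.extIso (ModuleCat.of R (R ⧸ 𝔞)) (ModuleCat.of R M) i).toLinearEquiv

end Transfer

namespace LocalExt

variable {R : Type u} [CommRing R] [IsNoetherianRing R] {𝔞 : Ideal R}

/-- For a torsion-free module `N`, a module whose local cohomology and `Ext` modules are those of
`N` shifted by one. -/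
lemma exists_shift {N : Type u} [AddCommGroup N] [Module R N] (h : 𝔞.powTorsion N = ⊥) :
    ∃ (Q : Type u) (_ : AddCommGroup Q) (_ : Module R Q),
      (∀ i, ExtFinite 𝔞 N (i + 1) → ExtFinite 𝔞 Q i) ∧
        ∀ i, Nonempty (limit 𝔞 Q i ≃ₗ[R] limit 𝔞 N (i + 1)) := by
  obtain ⟨E, _, _, f, _, hf, hE⟩ := exists_injective_embedding_of_powTorsion_eq_bot h
  have hfg : Function.Exact f (LinearMap.range f).mkQ := LinearMap.exact_map_mkQ_range f
  have hg := (LinearMap.range f).mkQ_surjective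
  have hsub {I : Ideal R} {n : ℕ} (hI : 𝔞 ^ n ≤ I) :
      ∀ i, Subsingleton (Abelian.Ext (ModuleCat.of R (R ⧸ I)) (ModuleCat.of R E) i)
    | 0 => subsingleton_ext_zero hE hI
    | i + 1 => subsingleton_ext_succ_of_injective _ i
  refine ⟨E ⧸ LinearMap.range f, inferInstance, inferInstance, fun i hi => ?_, fun i =>
    ⟨limitSuccEquiv hf hfg hg (fun n => hsub (le_refl (𝔞 ^ n))) i⟩⟩
  have : Module.Finite R _ := hi
  exact Module.Finite.equiv (extSuccEquiv hf hfg hg _ (hsub (pow_one 𝔞).le) i).symm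

lemma extFinite_limit_of_isFDLT_two (t : ℕ) (M : Type u) [AddCommGroup M] [Module R M]
    (hext : ∀ i ≤ t + 1, ExtFinite 𝔞 M i) (hfd : ∀ i < t, IsFDLT R 2 (limit 𝔞 M i)) :
    ∀ i < t, ∀ j, ExtFinite 𝔞 (limit 𝔞 M i) j := by
  induction t generalizing M with
  | zero => exact fun i hi => absurd hi (Nat.not_lt_zero i)
  | succ t ih =>
    set Γ := 𝔞.powTorsion M
    have hf := Γ.injective_subtype
    have hfg := Submodule.exact_subtype_mkQ Γ
    have hg := Γ.mkQ_surjective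
    have hN : 𝔞.powTorsion (M ⧸ Γ) = ⊥ := Ideal.powTorsion_quotient_powTorsion
    have hΓtop : 𝔞.powTorsion Γ = ⊤ := Ideal.powTorsion_powTorsion
    have hN0 : ExtFinite 𝔞 (M ⧸ Γ) 0 := by
      have := subsingleton_ext_zero hN (pow_one 𝔞).le
      exact (inferInstance : Module.Finite R (Abelian.Ext (ModuleCat.of R (R ⧸ 𝔞)) (ModuleCat.of R (M ⧸ Γ)) 0))
    have hΓ : ∀ j, ExtFinite 𝔞 Γ j := by
      obtain ⟨P, hP, hs⟩ := (hfd 0 (Nat.succ_pos t)).of_linearEquiv (limitZeroEquiv 𝔞 M)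
      exact ExtFinite.of_support_quotient_dim_le_one (.of_powTorsion_eq_top hΓtop) hP hs
        (.zero_of_injective hf (hext 0 (Nat.zero_le _)))
        (.left hf hfg hg hN0 (hext 1 (by omega)))
    obtain ⟨Q, _, _, hQ, hQN⟩ := exists_shift hN
    have e (i : ℕ) : limit 𝔞 Q i ≃ₗ[R] limit 𝔞 M (i + 1) :=
      (hQN i).some.trans (limitQuotientEquiv hf hfg hg hΓtop i).symm
    rintro (_ | i) hi j
    · exact (hΓ j).congr (limitZeroEquiv 𝔞 M).symm
    · refine (ih Q (fun k hk => hQ k ?_) (fun k hk => ?_) i (by omega) j).congr (e i)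
      · exact .right hf hfg hg (hext _ (by omega)) (hΓ _)
      · exact (hfd (k + 1) (by omega)).of_linearEquiv (e k).symm

end LocalExt

/-- Theorem 3.1: if `Ext^i_R(R/𝔞, M)` is finite for `i ≤ t+1` and `H^i_𝔞(M)` is `FD_{<2}`
for `i < t`, then `H^i_𝔞(M)` is `𝔞`-cofinite for `i < t`. -/
theorem localCohomology_isCofinite_of_isFDLT_two
    (R : Type u) [CommRing R] [IsNoetherianRing R] (𝔞 : Ideal R) (t : ℕ)
    (M : Type u) [AddCommGroup M] [Module R M]
    (hext : ∀ i ≤ t + 1, Module.Finite R (extModule R (R ⧸ 𝔞) M i))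
    (hfd : ∀ i < t, IsFDLT R 2 (localCohomologyModule R 𝔞 M i)) :
    ∀ i < t, IsCofinite R 𝔞 (localCohomologyModule R 𝔞 M i) := by
  intro i hi
  have e (k : ℕ) := LocalExt.limitEquivLocalCohomology 𝔞 M k
  have hfin := LocalExt.extFinite_limit_of_isFDLT_two t M
    (fun k hk => (finite_extModule_iff 𝔞 k).1 (hext k hk))
    (fun k hk => (hfd k hk).of_linearEquiv (e k).symm) i hi
  refine ⟨?_, fun j => (finite_extModule_iff 𝔞 j).2 ((hfin j).congr (e i))⟩
  have ht := Ideal.IsPowTorsion.of_powTorsion_eq_top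
    (Ideal.powTorsion_eq_top_of_surjective (e i).surjective (LocalExt.powTorsion_limit 𝔞 M i))
  exact ht.support_subset
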